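/- arXiv:2403.03353 — 3 statements merged into one kernel-verified Lean document; each statement's English description precedes it below -/
import Mathlib

section
/- Suppose m distinct points x_1,…,x_m ∈ ℝ^s and Y = [y_j^k] ∈ ℝ^{t×m} with Y ≠ 0 are given, and the functions K_k(x_j,·), j ∈ {1,…,m}, k ∈ {1,…,t}, are linearly independent in C₀(Θ). Let ĉ ∈ ℝ^{t×m} be a solution of the dual problem, let C* be its optimal value (which equals the optimal value of the MNI problem), and set ĝ(θ) := C*·Σ_{k=1}^t Σ_{j=1}^m ĉ_{kj} K_k(x_j,θ). Then for every extreme point f̂ of the solution set S_{X,Y} of the MNI problem, there exist γ_1,…,γ_{tm} ∈ ℝ with Σ_{ℓ=1}^{tm} γ_ℓ = ‖ĝ‖_∞ and elements h_1,…,h_{tm} ∈ ext(∂‖·‖_∞(ĝ)) such that f̂(x) = Σ_{ℓ=1}^{tm} γ_ℓ h_ℓ(x) for all x ∈ ℝ^s. -/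
open MeasureTheory Filter Topology
open scoped ZeroAtInfty BigOperators

noncomputable section

/-- The parameter space of a depth-`D` deep neural network with layer widths
`m 0, m 1, …, m D` (input dimension `m 0 = s`, output dimension `m D = t`). -/
abbrev Params (m : ℕ → ℕ) (D : ℕ) : Type :=
  (j : Fin D) → ((Fin (m (j.1 + 1)) → Fin (m j.1) → ℝ) × (Fin (m (j.1 + 1)) → ℝ))

/-- The deep neural network `N(x, θ)` of depth `D`, defined recursively by
`N¹(x) = W₁ x + b₁` and `N^{j+1}(x) = W_{j+1} σ(N^j(x)) + b_{j+1}`. -/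
def NNet (σ : ℝ → ℝ) (m : ℕ → ℕ) :
    (D : ℕ) → Params m D → (Fin (m 0) → ℝ) → Fin (m D) → ℝ
  | 0, _, x => x
  | 1, θ, x => fun i => (∑ k, (θ ⟨0, Nat.one_pos⟩).1 i k * x k) + (θ ⟨0, Nat.one_pos⟩).2 i
  | (D + 2), θ, x => fun i =>
      (∑ k, (θ (Fin.last (D + 1))).1 i k *
          σ (NNet σ m (D + 1) (fun j => θ j.castSucc) x k))
        + (θ (Fin.last (D + 1))).2 i

/-- The integral of a function against a finite signed (Radon) measure,
via the Jordan decomposition. -/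
def sInt {Θ : Type*} [MeasurableSpace Θ] (μ : SignedMeasure Θ) (f : Θ → ℝ) : ℝ :=
  (∫ θ, f θ ∂μ.toJordanDecomposition.posPart) - ∫ θ, f θ ∂μ.toJordanDecomposition.negPart

/-- The total variation norm of a signed measure. -/
def tvNorm {Θ : Type*} [MeasurableSpace Θ] (μ : SignedMeasure Θ) : ℝ :=
  (μ.totalVariation Set.univ).toReal

/-- `f_μ^k(x) := ∫_Θ N_k(x,θ) ρ(θ) dμ(θ)`. -/
def fMu (σ : ℝ → ℝ) (m : ℕ → ℕ) (D : ℕ) (ρ : Params m D → ℝ)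
    (μ : SignedMeasure (Params m D)) : (Fin (m 0) → ℝ) → Fin (m D) → ℝ :=
  fun x k => sInt μ fun θ => NNet σ m D θ x k * ρ θ

/-- The set `B_N = {f_μ : μ ∈ M(Θ)}`. -/
def BNset (σ : ℝ → ℝ) (m : ℕ → ℕ) (D : ℕ) (ρ : Params m D → ℝ) :
    Set ((Fin (m 0) → ℝ) → Fin (m D) → ℝ) :=
  {f | ∃ μ : SignedMeasure (Params m D), fMu σ m D ρ μ = f}

/-- The norm `‖f‖_{B_N} = inf {‖ν‖_TV : f_ν = f}`. -/
def BNnorm (σ : ℝ → ℝ) (m : ℕ → ℕ) (D : ℕ) (ρ : Params m D → ℝ)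
    (f : (Fin (m 0) → ℝ) → Fin (m D) → ℝ) : ℝ :=
  sInf (tvNorm '' {ν : SignedMeasure (Params m D) | fMu σ m D ρ ν = f})

/-- `S`: the closed linear span in `C₀(Θ)` of the functions `θ ↦ N_k(x,θ)ρ(θ)`
(given here as the bundled family `Kb`). -/
def Sspan (m : ℕ → ℕ) (D : ℕ)
    (Kb : (Fin (m 0) → ℝ) → Fin (m D) → C₀(Params m D, ℝ)) :
    Submodule ℝ C₀(Params m D, ℝ) :=
  (Submodule.span ℝ
    (Set.range fun p : (Fin (m 0) → ℝ) × Fin (m D) => Kb p.1 p.2)).topologicalClosure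

/-- `V_N := span {K_k(x_j, ·) : j, k}`. -/
def VN (m : ℕ → ℕ) (D : ℕ)
    (Kb : (Fin (m 0) → ℝ) → Fin (m D) → C₀(Params m D, ℝ))
    (M : ℕ) (x : Fin M → (Fin (m 0) → ℝ)) : Submodule ℝ C₀(Params m D, ℝ) :=
  Submodule.span ℝ (Set.range fun p : Fin (m D) × Fin M => Kb (x p.2) p.1)

/-- The interpolation condition `f(x_j) = y_j`, i.e. `f_k(x_j) = y_j^k` for all `j, k`. -/
def interpolates (m : ℕ → ℕ) (D : ℕ) (M : ℕ) (x : Fin M → (Fin (m 0) → ℝ))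
    (Y : Fin (m D) → Fin M → ℝ) (f : (Fin (m 0) → ℝ) → Fin (m D) → ℝ) : Prop :=
  ∀ (j : Fin M) (k : Fin (m D)), f (x j) k = Y k j

/-- The solution set `S_{X,Y}` of the MNI problem
`inf {‖f‖_{B_N} : f ∈ B_N, f(x_j) = y_j}`. -/
def MNISolSet (σ : ℝ → ℝ) (m : ℕ → ℕ) (D : ℕ) (ρ : Params m D → ℝ)
    (M : ℕ) (x : Fin M → (Fin (m 0) → ℝ)) (Y : Fin (m D) → Fin M → ℝ) :
    Set ((Fin (m 0) → ℝ) → Fin (m D) → ℝ) :=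
  {f | f ∈ BNset σ m D ρ ∧ interpolates m D M x Y f ∧
    ∀ μ : SignedMeasure (Params m D), interpolates m D M x Y (fMu σ m D ρ μ) →
      BNnorm σ m D ρ f ≤ BNnorm σ m D ρ (fMu σ m D ρ μ)}

/-- The solution set of the measure MNI problem
`inf {‖μ‖_TV : μ ∈ M(Θ), ∫ K_k(x_j,·) dμ = y_j^k}`. -/
def MeasSolSet (σ : ℝ → ℝ) (m : ℕ → ℕ) (D : ℕ) (ρ : Params m D → ℝ)
    (M : ℕ) (x : Fin M → (Fin (m 0) → ℝ)) (Y : Fin (m D) → Fin M → ℝ) :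
    Set (SignedMeasure (Params m D)) :=
  {μ | interpolates m D M x Y (fMu σ m D ρ μ) ∧
    ∀ ν : SignedMeasure (Params m D), interpolates m D M x Y (fMu σ m D ρ ν) →
      tvNorm μ ≤ tvNorm ν}

/-- The subdifferential `∂‖·‖_∞(g) ⊆ B_N` of the supremum norm at `g ∈ S`, viewing `B_N`
as the dual of `S` via the (representation independent) pairing `⟨f_μ, g⟩ = ∫ g dμ`:
`∂‖·‖_∞(g) = {f_μ ∈ B_N : ‖f_μ‖_{B_N} = 1, ∫ g dμ = ‖g‖_∞}`. -/
def subdiffSup (σ : ℝ → ℝ) (m : ℕ → ℕ) (D : ℕ) (ρ : Params m D → ℝ)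
    (g : C₀(Params m D, ℝ)) : Set ((Fin (m 0) → ℝ) → Fin (m D) → ℝ) :=
  {f | f ∈ BNset σ m D ρ ∧ BNnorm σ m D ρ f = 1 ∧
    ∀ μ : SignedMeasure (Params m D), fMu σ m D ρ μ = f → sInt μ (fun θ => g θ) = ‖g‖}

/-- Feasibility for the dual problem: `‖∑_{k,j} c_{kj} K_k(x_j,·)‖_∞ = 1`. -/
def dualFeasible (m : ℕ → ℕ) (D : ℕ)
    (Kb : (Fin (m 0) → ℝ) → Fin (m D) → C₀(Params m D, ℝ))
    (M : ℕ) (x : Fin M → (Fin (m 0) → ℝ)) (c : Fin (m D) → Fin M → ℝ) : Prop :=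
  ‖∑ k, ∑ j, c k j • Kb (x j) k‖ = 1

/-- The objective `∑_{k,j} c_{kj} y_j^k` of the dual problem. -/
def dualObjective (m : ℕ → ℕ) (D : ℕ) (M : ℕ) (Y : Fin (m D) → Fin M → ℝ)
    (c : Fin (m D) → Fin M → ℝ) : ℝ :=
  ∑ k, ∑ j, c k j * Y k j

/-- `c` is a solution of the dual problem. -/
def dualSolves (m : ℕ → ℕ) (D : ℕ)
    (Kb : (Fin (m 0) → ℝ) → Fin (m D) → C₀(Params m D, ℝ))
    (M : ℕ) (x : Fin M → (Fin (m 0) → ℝ)) (Y : Fin (m D) → Fin M → ℝ)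
    (c : Fin (m D) → Fin M → ℝ) : Prop :=
  dualFeasible m D Kb M x c ∧
    ∀ c' : Fin (m D) → Fin M → ℝ, dualFeasible m D Kb M x c' →
      dualObjective m D M Y c' ≤ dualObjective m D M Y c

/-- `ĝ := C* · ∑_{k,j} ĉ_{kj} K_k(x_j,·)`, where `C*` is the optimal dual value
(the value of the dual objective at the dual solution `c`). -/
def ghat (m : ℕ → ℕ) (D : ℕ)
    (Kb : (Fin (m 0) → ℝ) → Fin (m D) → C₀(Params m D, ℝ))
    (M : ℕ) (x : Fin M → (Fin (m 0) → ℝ)) (Y : Fin (m D) → Fin M → ℝ)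
    (c : Fin (m D) → Fin M → ℝ) : C₀(Params m D, ℝ) :=
  dualObjective m D M Y c • ∑ k, ∑ j, c k j • Kb (x j) k

/-- `Θ(g) := {θ ∈ Θ : |g(θ)| = ‖g‖_∞}`. -/
def ThetaSet (m : ℕ → ℕ) (D : ℕ) (g : C₀(Params m D, ℝ)) : Set (Params m D) :=
  {θ | |g θ| = ‖g‖}

/-- The regularization objective `Q(I_X(f) − Y) + λ ‖f‖_{B_N}`. -/
def regObj (σ : ℝ → ℝ) (m : ℕ → ℕ) (D : ℕ) (ρ : Params m D → ℝ)
    (M : ℕ) (x : Fin M → (Fin (m 0) → ℝ)) (Y : Fin (m D) → Fin M → ℝ)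
    (lam : ℝ) (Q : (Fin (m D) → Fin M → ℝ) → ℝ)
    (f : (Fin (m 0) → ℝ) → Fin (m D) → ℝ) : ℝ :=
  Q ((fun k j => f (x j) k) - Y) + lam * BNnorm σ m D ρ f

/-- The solution set `R_{X,Y}` of the regularization problem. -/
def RegSolSet (σ : ℝ → ℝ) (m : ℕ → ℕ) (D : ℕ) (ρ : Params m D → ℝ)
    (M : ℕ) (x : Fin M → (Fin (m 0) → ℝ)) (Y : Fin (m D) → Fin M → ℝ)
    (lam : ℝ) (Q : (Fin (m D) → Fin M → ℝ) → ℝ) :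
    Set ((Fin (m 0) → ℝ) → Fin (m D) → ℝ) :=
  {f | f ∈ BNset σ m D ρ ∧
    ∀ μ : SignedMeasure (Params m D),
      regObj σ m D ρ M x Y lam Q f ≤ regObj σ m D ρ M x Y lam Q (fMu σ m D ρ μ)}

/-- `D_{X,Y} := I_X(R_{X,Y})`. -/
def DXY (σ : ℝ → ℝ) (m : ℕ → ℕ) (D : ℕ) (ρ : Params m D → ℝ)
    (M : ℕ) (x : Fin M → (Fin (m 0) → ℝ)) (Y : Fin (m D) → Fin M → ℝ)
    (lam : ℝ) (Q : (Fin (m D) → Fin M → ℝ) → ℝ) : Set (Fin (m D) → Fin M → ℝ) :=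
  (fun f => fun k j => f (x j) k) '' RegSolSet σ m D ρ M x Y lam Q

lemma abs_zeroAtInfty_le_norm {Θ : Type*} [TopologicalSpace Θ] (f : C₀(Θ, ℝ)) (θ : Θ) :
    |f θ| ≤ ‖f‖ :=
  f.toBCF.norm_coe_le_norm θ

section SignedMeasureIntegral

variable {Θ : Type*} [MeasurableSpace Θ]

lemma posPart_add_eq_negPart_add {μ : SignedMeasure Θ} {a b : Measure Θ}
    [IsFiniteMeasure a] [IsFiniteMeasure b] (h : μ = a.toSignedMeasure - b.toSignedMeasure) :
    μ.toJordanDecomposition.posPart + b = μ.toJordanDecomposition.negPart + a := by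
  have h1 := μ.toSignedMeasure_toJordanDecomposition
  rw [JordanDecomposition.toSignedMeasure] at h1
  rw [← Measure.toSignedMeasure_eq_toSignedMeasure_iff, Measure.toSignedMeasure_add,
    Measure.toSignedMeasure_add]
  rw [sub_eq_iff_eq_add] at h1
  rw [h1]
  nth_rewrite 1 [h]
  abel

lemma sInt_eq_of_eq_sub {μ : SignedMeasure Θ} {a b : Measure Θ}
    [IsFiniteMeasure a] [IsFiniteMeasure b] (h : μ = a.toSignedMeasure - b.toSignedMeasure)
    {f : Θ → ℝ} (hf : ∀ ν : Measure Θ, IsFiniteMeasure ν → Integrable f ν) :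
    sInt μ f = ∫ θ, f θ ∂a - ∫ θ, f θ ∂b := by
  have h1 := congrArg (fun ν : Measure Θ => ∫ θ, f θ ∂ν) (posPart_add_eq_negPart_add h)
  beta_reduce at h1
  rw [integral_add_measure (hf _ inferInstance) (hf _ inferInstance),
    integral_add_measure (hf _ inferInstance) (hf _ inferInstance)] at h1
  unfold sInt
  linarith

lemma tvNorm_eq (μ : SignedMeasure Θ) :
    tvNorm μ = μ.toJordanDecomposition.posPart.real Set.univ
      + μ.toJordanDecomposition.negPart.real Set.univ := by
  rw [tvNorm, SignedMeasure.totalVariation, ← measureReal_def, measureReal_add_apply]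

lemma tvNorm_le_of_eq_sub {μ : SignedMeasure Θ} {a b : Measure Θ}
    [IsFiniteMeasure a] [IsFiniteMeasure b] (h : μ = a.toSignedMeasure - b.toSignedMeasure) :
    tvNorm μ ≤ a.real Set.univ + b.real Set.univ := by
  obtain ⟨S, hS, -, -, hp, hn⟩ := μ.toJordanDecomposition.exists_compl_positive_negative
  have key := posPart_add_eq_negPart_add h
  have h1 := congrArg (fun ν : Measure Θ => ν.real Sᶜ) key
  have h2 := congrArg (fun ν : Measure Θ => ν.real S) key
  beta_reduce at h1 h2
  rw [measureReal_add_apply, measureReal_add_apply] at h1 h2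
  have hp' : μ.toJordanDecomposition.posPart.real S = 0 := by simp [measureReal_def, hp]
  have hn' : μ.toJordanDecomposition.negPart.real Sᶜ = 0 := by simp [measureReal_def, hn]
  rw [tvNorm_eq, ← measureReal_add_measureReal_compl hS (μ := a),
    ← measureReal_add_measureReal_compl hS (μ := b),
    ← measureReal_add_measureReal_compl hS (μ := μ.toJordanDecomposition.posPart),
    ← measureReal_add_measureReal_compl hS (μ := μ.toJordanDecomposition.negPart)]
  linarith [measureReal_nonneg (μ := a) (s := S), measureReal_nonneg (μ := b) (s := Sᶜ)]

lemma eq_posPart_sub_negPart (μ : SignedMeasure Θ) :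
    μ = μ.toJordanDecomposition.posPart.toSignedMeasure
      - μ.toJordanDecomposition.negPart.toSignedMeasure :=
  μ.toSignedMeasure_toJordanDecomposition.symm

lemma add_eq_posPart_sub_negPart (μ ν : SignedMeasure Θ) :
    μ + ν = (μ.toJordanDecomposition.posPart + ν.toJordanDecomposition.posPart).toSignedMeasure
      - (μ.toJordanDecomposition.negPart + ν.toJordanDecomposition.negPart).toSignedMeasure := by
  rw [Measure.toSignedMeasure_add, Measure.toSignedMeasure_add]
  nth_rewrite 1 [eq_posPart_sub_negPart μ, eq_posPart_sub_negPart ν]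
  abel

lemma sInt_add (μ ν : SignedMeasure Θ) {f : Θ → ℝ}
    (hf : ∀ ν : Measure Θ, IsFiniteMeasure ν → Integrable f ν) :
    sInt (μ + ν) f = sInt μ f + sInt ν f := by
  rw [sInt_eq_of_eq_sub (add_eq_posPart_sub_negPart μ ν) hf,
    integral_add_measure (hf _ inferInstance) (hf _ inferInstance),
    integral_add_measure (hf _ inferInstance) (hf _ inferInstance), sInt, sInt]
  ring

lemma sInt_smul (r : ℝ) (μ : SignedMeasure Θ) (f : Θ → ℝ) :
    sInt (r • μ) f = r * sInt μ f := by
  unfold sInt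
  rw [SignedMeasure.toJordanDecomposition_smul_real]
  rcases le_or_gt 0 r with hr | hr
  · rw [JordanDecomposition.real_smul_posPart_nonneg _ _ hr,
      JordanDecomposition.real_smul_negPart_nonneg _ _ hr, integral_smul_nnreal_measure,
      integral_smul_nnreal_measure, NNReal.smul_def, NNReal.smul_def, Real.coe_toNNReal _ hr,
      smul_eq_mul, smul_eq_mul]
    ring
  · rw [JordanDecomposition.real_smul_posPart_neg _ _ hr,
      JordanDecomposition.real_smul_negPart_neg _ _ hr, integral_smul_nnreal_measure,
      integral_smul_nnreal_measure, NNReal.smul_def, NNReal.smul_def,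
      Real.coe_toNNReal _ (by linarith), smul_eq_mul, smul_eq_mul]
    ring

lemma tvNorm_add_le (μ ν : SignedMeasure Θ) : tvNorm (μ + ν) ≤ tvNorm μ + tvNorm ν := by
  refine (tvNorm_le_of_eq_sub (add_eq_posPart_sub_negPart μ ν)).trans_eq ?_
  rw [tvNorm_eq, tvNorm_eq, measureReal_add_apply, measureReal_add_apply]
  ring

lemma tvNorm_smul (r : ℝ) (μ : SignedMeasure Θ) : tvNorm (r • μ) = ‖r‖ * tvNorm μ := by
  rw [tvNorm_eq, tvNorm_eq, SignedMeasure.toJordanDecomposition_smul_real, Real.norm_eq_abs]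
  rcases le_or_gt 0 r with hr | hr
  · rw [JordanDecomposition.real_smul_posPart_nonneg _ _ hr,
      JordanDecomposition.real_smul_negPart_nonneg _ _ hr, measureReal_nnreal_smul_apply,
      measureReal_nnreal_smul_apply, Real.coe_toNNReal _ hr, abs_of_nonneg hr]
    ring
  · rw [JordanDecomposition.real_smul_posPart_neg _ _ hr,
      JordanDecomposition.real_smul_negPart_neg _ _ hr, measureReal_nnreal_smul_apply,
      measureReal_nnreal_smul_apply, Real.coe_toNNReal _ (by linarith), abs_of_neg hr]
    ring

/-- The total variation norm as a seminorm on signed measures. -/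
def tvSeminorm (Θ : Type*) [MeasurableSpace Θ] : Seminorm ℝ (SignedMeasure Θ) :=
  Seminorm.of tvNorm tvNorm_add_le tvNorm_smul

lemma tvNorm_dirac_le (θ : Θ) : tvNorm (Measure.dirac θ).toSignedMeasure ≤ 1 := by
  refine (tvNorm_le_of_eq_sub (a := Measure.dirac θ) (b := 0) (by simp)).trans_eq ?_
  simp

variable [TopologicalSpace Θ] [OpensMeasurableSpace Θ]

lemma integrable_zeroAtInfty (f : C₀(Θ, ℝ)) (ν : Measure Θ) (_ : IsFiniteMeasure ν) :
    Integrable (fun θ => f θ) ν :=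
  f.toBCF.integrable ν

/-- Integration of a fixed `f ∈ C₀(Θ)` as a linear functional on signed measures. -/
def sIntLin (f : C₀(Θ, ℝ)) : SignedMeasure Θ →ₗ[ℝ] ℝ where
  toFun μ := sInt μ fun θ => f θ
  map_add' μ ν := sInt_add μ ν (integrable_zeroAtInfty f)
  map_smul' r μ := sInt_smul r μ _

lemma sIntLin_apply (f : C₀(Θ, ℝ)) (μ : SignedMeasure Θ) :
    sIntLin f μ = sInt μ fun θ => f θ := rfl

lemma sIntLin_dirac (f : C₀(Θ, ℝ)) (θ : Θ) :
    sIntLin f (Measure.dirac θ).toSignedMeasure = f θ := by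
  rw [sIntLin_apply, sInt_eq_of_eq_sub (a := Measure.dirac θ) (b := 0) (by simp)
    (integrable_zeroAtInfty f)]
  simp only [integral_zero_measure, sub_zero]
  exact integral_dirac' _ _ f.continuous.stronglyMeasurable

lemma sIntLin_add (f g : C₀(Θ, ℝ)) : sIntLin (f + g) = sIntLin f + sIntLin g := by
  ext μ
  have hf := integrable_zeroAtInfty f
  have hg := integrable_zeroAtInfty g
  simp only [sIntLin_apply, LinearMap.add_apply, sInt, ZeroAtInftyContinuousMap.add_apply]
  rw [integral_add (hf _ inferInstance) (hg _ inferInstance),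
    integral_add (hf _ inferInstance) (hg _ inferInstance)]
  ring

lemma sIntLin_smul (r : ℝ) (f : C₀(Θ, ℝ)) : sIntLin (r • f) = r • sIntLin f := by
  ext μ
  simp only [sIntLin_apply, LinearMap.smul_apply, sInt, ZeroAtInftyContinuousMap.smul_apply,
    smul_eq_mul, integral_const_mul]
  ring

lemma sIntLin_sum {ι : Type*} (s : Finset ι) (f : ι → C₀(Θ, ℝ)) :
    sIntLin (∑ i ∈ s, f i) = ∑ i ∈ s, sIntLin (f i) := by
  classical
  induction s using Finset.induction_on with
  | empty =>
    have h := sIntLin_smul (0 : ℝ) (0 : C₀(Θ, ℝ))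
    rwa [zero_smul, zero_smul] at h
  | insert a s ha ih => rw [Finset.sum_insert ha, Finset.sum_insert ha, sIntLin_add, ih]

lemma abs_sIntLin_le (f : C₀(Θ, ℝ)) (μ : SignedMeasure Θ) :
    |sIntLin f μ| ≤ ‖f‖ * tvNorm μ := by
  have h (ν : Measure Θ) [IsFiniteMeasure ν] : |∫ θ, f θ ∂ν| ≤ ‖f‖ * ν.real Set.univ :=
    norm_integral_le_of_norm_le_const (f := fun θ => f θ)
      (.of_forall (abs_zeroAtInfty_le_norm f))
  rw [sIntLin_apply, sInt, tvNorm_eq, mul_add]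
  exact (abs_sub _ _).trans (add_le_add (h _) (h _))

end SignedMeasureIntegral

section QuotientNorm

variable {E V : Type*} [AddCommGroup E] [Module ℝ E] [AddCommGroup V] [Module ℝ V]

/-- The norm induced by the seminorm `p` along the linear map `T`: the infimum of `p` over the
fibre of `T` above `v`. -/
def fibreNorm (T : E →ₗ[ℝ] V) (p : Seminorm ℝ E) (v : V) : ℝ :=
  sInf (p '' {e | T e = v})

variable (T : E →ₗ[ℝ] V) (p : Seminorm ℝ E)

lemma fibreNorm_nonneg (v : V) : 0 ≤ fibreNorm T p v := by
  refine Real.sInf_nonneg ?_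
  rintro _ ⟨e, -, rfl⟩
  exact apply_nonneg p e

lemma fibreNorm_le (e : E) : fibreNorm T p (T e) ≤ p e := by
  refine csInf_le ⟨0, ?_⟩ ⟨e, rfl, rfl⟩
  rintro _ ⟨e, -, rfl⟩
  exact apply_nonneg p e

lemma exists_lt_of_fibreNorm_lt {v : V} (hv : v ∈ LinearMap.range T) {r : ℝ}
    (h : fibreNorm T p v < r) : ∃ e, T e = v ∧ p e < r := by
  obtain ⟨e, he⟩ := hv
  obtain ⟨_, ⟨e, he, rfl⟩, hlt⟩ := exists_lt_of_csInf_lt (s := p '' {e | T e = v})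
    ⟨_, e, he, rfl⟩ h
  exact ⟨e, he, hlt⟩

lemma fibreNorm_add_le {v w : V} (hv : v ∈ LinearMap.range T) (hw : w ∈ LinearMap.range T) :
    fibreNorm T p (v + w) ≤ fibreNorm T p v + fibreNorm T p w := by
  refine le_of_forall_pos_le_add fun ε hε => ?_
  obtain ⟨a, rfl, ha⟩ := exists_lt_of_fibreNorm_lt T p hv (lt_add_of_pos_right _ (half_pos hε))
  obtain ⟨b, rfl, hb⟩ := exists_lt_of_fibreNorm_lt T p hw (lt_add_of_pos_right _ (half_pos hε))
  rw [← map_add]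
  linarith [fibreNorm_le T p (a + b), map_add_le_add p a b]

lemma fibreNorm_zero : fibreNorm T p 0 = 0 := by
  refine le_antisymm ?_ (fibreNorm_nonneg T p 0)
  simpa using fibreNorm_le T p 0

lemma fibreNorm_smul_le {v : V} (hv : v ∈ LinearMap.range T) {c : ℝ} (hc : c ≠ 0) :
    fibreNorm T p (c • v) ≤ |c| * fibreNorm T p v := by
  have hc' := abs_pos.2 hc
  refine le_of_forall_pos_le_add fun ε hε => ?_
  obtain ⟨a, rfl, ha⟩ := exists_lt_of_fibreNorm_lt T p hv
    (lt_add_of_pos_right _ (div_pos hε hc'))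
  rw [← map_smul]
  refine (fibreNorm_le T p _).trans ?_
  rw [map_smul_eq_mul, Real.norm_eq_abs]
  refine (mul_le_mul_of_nonneg_left ha.le hc'.le).trans_eq ?_
  field_simp

lemma fibreNorm_smul {v : V} (hv : v ∈ LinearMap.range T) (c : ℝ) :
    fibreNorm T p (c • v) = |c| * fibreNorm T p v := by
  rcases eq_or_ne c 0 with rfl | hc
  · simp [fibreNorm_zero]
  refine le_antisymm (fibreNorm_smul_le T p hv hc) ?_
  have h := fibreNorm_smul_le T p (Submodule.smul_mem _ c hv) (inv_ne_zero hc)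
  rw [inv_smul_smul₀ hc, abs_inv] at h
  rwa [le_inv_mul_iff₀ (abs_pos.2 hc)] at h

/-- A norming functional for the fibre norm. -/
lemma exists_dual_fibreNorm (e : E) :
    ∃ g : E →ₗ[ℝ] ℝ, g e = fibreNorm T p (T e) ∧ (∀ a, g a ≤ p a) ∧
      LinearMap.ker T ≤ LinearMap.ker g := by
  have hm (a : E) : T a ∈ LinearMap.range T := ⟨a, rfl⟩
  obtain ⟨g, hg, hle⟩ := exists_extension_of_le_sublinear
    (LinearPMap.mkSpanSingleton' (σ := RingHom.id ℝ) e (fibreNorm T p (T e)) (fun c hc => by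
      have h := fibreNorm_smul T p (hm e) c
      rw [← map_smul, hc, map_zero, fibreNorm_zero] at h
      rcases mul_eq_zero.1 h.symm with h | h
      · simp [abs_eq_zero.1 h]
      · simp [h]))
    (fun a => fibreNorm T p (T a))
    (fun c hc a => by rw [map_smul, fibreNorm_smul T p (hm a), abs_of_pos hc])
    (fun a b => by rw [map_add]; exact fibreNorm_add_le T p (hm a) (hm b))
    (by
      rintro ⟨a, ha⟩
      obtain ⟨c, rfl⟩ := Submodule.mem_span_singleton.1 ha
      rw [LinearPMap.mkSpanSingleton'_apply]
      simp only [map_smul, fibreNorm_smul T p (hm e), RingHom.id_apply, smul_eq_mul]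
      exact mul_le_mul_of_nonneg_right (le_abs_self c) (fibreNorm_nonneg T p _))
  refine ⟨g, ?_, fun a => (hle a).trans (fibreNorm_le T p a), fun a ha => ?_⟩
  · have h := hg ⟨e, Submodule.mem_span_singleton_self e⟩
    exact h.trans (LinearPMap.mkSpanSingleton'_apply_self _ _ _ _)
  · rw [LinearMap.mem_ker] at ha ⊢
    have h1 := hle a
    have h2 := hle (-a)
    simp only [map_neg, ha, neg_zero, fibreNorm_zero] at h1 h2
    linarith

end QuotientNorm

section FaceDirection

variable {V : Type*} [AddCommGroup V] [Module ℝ V]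

/-- The linear directions of the face of the convex set `A` generated by `f ∈ A`. -/
def faceDirection {A : Set V} (hA : Convex ℝ A) {f : V} (hf : f ∈ A) : Submodule ℝ V where
  carrier := {v | ∃ ε : ℝ, 0 < ε ∧ ∀ t : ℝ, |t| ≤ ε → f + t • v ∈ A}
  zero_mem' := ⟨1, one_pos, fun t _ => by simpa using hf⟩
  add_mem' := by
    rintro v w ⟨ε, hε, hv⟩ ⟨δ, hδ, hw⟩
    refine ⟨min ε δ / 2, by positivity, fun t ht => ?_⟩
    have h2 : |2 * t| ≤ min ε δ := by
      rw [abs_mul, abs_two]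
      linarith
    have h := hA (hv (2 * t) (h2.trans (min_le_left _ _)))
      (hw (2 * t) (h2.trans (min_le_right _ _)))
      (show (0 : ℝ) ≤ 1 / 2 by norm_num) (show (0 : ℝ) ≤ 1 / 2 by norm_num) (by norm_num)
    convert h using 1
    module
  smul_mem' := by
    rintro c v ⟨ε, hε, hv⟩
    refine ⟨ε / (|c| + 1), by positivity, fun t ht => ?_⟩
    rw [smul_smul]
    refine hv _ ?_
    rw [abs_mul]
    rw [le_div_iff₀ (by positivity)] at ht
    nlinarith [abs_nonneg t, abs_nonneg c]

variable {A : Set V} (hA : Convex ℝ A) {f : V} (hf : f ∈ A)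

lemma mem_faceDirection_of_mem {v : V} {s r : ℝ} (hs : 0 < s) (hr : 0 < r)
    (h₁ : f + s • v ∈ A) (h₂ : f - r • v ∈ A) : v ∈ faceDirection hA hf := by
  refine ⟨min s r, by positivity, fun t ht => ?_⟩
  rcases le_or_gt 0 t with h | h
  · rw [abs_of_nonneg h] at ht
    have hts := ht.trans (min_le_left _ _)
    have := hA h₁ hf (div_nonneg h hs.le) (sub_nonneg.2 ((div_le_one hs).2 hts)) (by ring)
    convert this using 1
    rw [smul_add, smul_smul, div_mul_cancel₀ _ hs.ne']
    module
  · rw [abs_of_neg h] at ht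
    have htr := ht.trans (min_le_right _ _)
    have := hA h₂ hf (div_nonneg (neg_nonneg.2 h.le) hr.le)
      (sub_nonneg.2 ((div_le_one hr).2 htr)) (by ring)
    convert this using 1
    rw [smul_sub, smul_smul, div_mul_cancel₀ _ hr.ne']
    module

lemma mem_extremePoints_of_faceDirection_eq_bot (h : faceDirection hA hf = ⊥) :
    f ∈ A.extremePoints ℝ := by
  refine ⟨hf, ?_⟩
  rintro a ha b hb ⟨s, r, hs, hr, hsr, rfl⟩
  have hmem : a - (s • a + r • b) ∈ faceDirection hA hf := by
    refine mem_faceDirection_of_mem hA hf one_pos (div_pos hs hr) ?_ ?_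
    · convert ha using 1
      module
    · convert hb using 1
      obtain rfl : s = 1 - r := by linarith
      match_scalars <;> field_simp <;> ring
  rw [h, Submodule.mem_bot, sub_eq_zero] at hmem
  exact hmem

/-- Along every face direction through `f`, the set `A` has a last point. -/
def ExitsAlongFaces (A : Set V) : Prop :=
  ∀ f ∈ A, ∀ v ≠ 0, (∃ ε : ℝ, 0 < ε ∧ ∀ t : ℝ, |t| ≤ ε → f + t • v ∈ A) →
    ∃ β : ℝ, 0 < β ∧ f + β • v ∈ A ∧ ∀ t : ℝ, β < t → f + t • v ∉ A

lemma faceDirection_lt {v : V} (hv : v ∈ faceDirection hA hf) {β : ℝ} (hβ : 0 < β)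
    (hβA : f + β • v ∈ A) (hexit : ∀ t : ℝ, β < t → f + t • v ∉ A) :
    faceDirection hA hβA < faceDirection hA hf := by
  obtain ⟨ε, hε, hv'⟩ := hv
  refine lt_of_le_of_ne ?_ ?_
  · rintro w ⟨δ, hδ, hw⟩
    have hm := hv' (-ε) (by rw [abs_neg, abs_of_pos hε])
    have aux : ∀ t : ℝ, |t| ≤ δ → f + (ε / (β + ε) * t) • w ∈ A := fun t ht => by
      have := hA (hw t ht) hm (a := ε / (β + ε)) (b := β / (β + ε)) (by positivity)
        (by positivity) (by field_simp; ring)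
      convert this using 1
      match_scalars <;> field_simp <;> ring
    have h₁ := aux δ (abs_of_pos hδ).le
    have h₂ := aux (-δ) (by rw [abs_neg, abs_of_pos hδ])
    refine mem_faceDirection_of_mem hA hf (s := ε / (β + ε) * δ) (r := ε / (β + ε) * δ)
      (by positivity) (by positivity) h₁ ?_
    convert h₂ using 1
    module
  · intro heq
    have : v ∈ faceDirection hA hβA := by
      rw [heq]
      exact ⟨ε, hε, hv'⟩
    obtain ⟨δ, hδ, h⟩ := this
    refine hexit (β + δ) (by linarith) ?_
    convert h δ (abs_of_pos hδ).le using 1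
    module

lemma exists_extremePoint_sub_mem (hex : ExitsAlongFaces A) (n : ℕ) :
    ∀ f (hf : f ∈ A), FiniteDimensional ℝ (faceDirection hA hf) →
      Module.finrank ℝ (faceDirection hA hf) ≤ n →
      ∃ e ∈ A.extremePoints ℝ, f - e ∈ faceDirection hA hf := by
  induction n with
  | zero =>
    intro f hf _ hn
    refine ⟨f, mem_extremePoints_of_faceDirection_eq_bot hA hf ?_, by simp⟩
    exact Submodule.finrank_eq_zero.1 (Nat.le_zero.1 hn)
  | succ n ih =>
    intro f hf _ hn
    by_cases hb : faceDirection hA hf = ⊥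
    · exact ⟨f, mem_extremePoints_of_faceDirection_eq_bot hA hf hb, by simp⟩
    obtain ⟨v, hv, hv0⟩ := Submodule.exists_mem_ne_zero_of_ne_bot hb
    obtain ⟨β, hβ, hβA, hexit⟩ := hex f hf v hv0 hv
    have hlt := faceDirection_lt hA hf hv hβ hβA hexit
    have := Submodule.finrank_lt_finrank_of_lt hlt
    obtain ⟨e, he, hfe⟩ := ih _ hβA (Submodule.finiteDimensional_of_le hlt.le) (by omega)
    refine ⟨e, he, ?_⟩
    convert Submodule.sub_mem _ (hlt.le hfe) (Submodule.smul_mem _ β hv) using 1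
    module

/-- A point whose face has dimension at most `n` is an affine combination of `n + 1` extreme
points. -/
lemma exists_affine_combination_extremePoints (hex : ExitsAlongFaces A) (n : ℕ) :
    ∀ f (hf : f ∈ A), FiniteDimensional ℝ (faceDirection hA hf) →
      Module.finrank ℝ (faceDirection hA hf) ≤ n →
      ∃ (γ : Fin (n + 1) → ℝ) (h : Fin (n + 1) → V), ∑ i, γ i = 1 ∧
        (∀ i, h i ∈ A.extremePoints ℝ) ∧ f = ∑ i, γ i • h i := by
  induction n with
  | zero =>
    intro f hf _ hn
    have := mem_extremePoints_of_faceDirection_eq_bot hA hf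
      (Submodule.finrank_eq_zero.1 (Nat.le_zero.1 hn))
    exact ⟨fun _ => 1, fun _ => f, by simp, fun _ => this, by simp⟩
  | succ n ih =>
    intro f hf hfin hn
    obtain ⟨e, he, hv⟩ := exists_extremePoint_sub_mem hA hex _ f hf hfin hn
    rcases eq_or_ne (f - e) 0 with hv0 | hv0
    · obtain rfl := sub_eq_zero.1 hv0
      refine ⟨Fin.cons 1 0, fun _ => f, by simp [Fin.sum_univ_succ], fun _ => he, ?_⟩
      simp [Fin.sum_univ_succ]
    obtain ⟨β, hβ, hβA, hexit⟩ := hex f hf _ hv0 hv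
    have hlt := faceDirection_lt hA hf hv hβ hβA hexit
    have := Submodule.finrank_lt_finrank_of_lt hlt
    obtain ⟨γ, h, hγ, hh, hfe⟩ := ih _ hβA (Submodule.finiteDimensional_of_le hlt.le) (by omega)
    refine ⟨Fin.cons (β / (1 + β)) fun i => (1 + β)⁻¹ * γ i, Fin.cons e h, ?_, ?_, ?_⟩
    · simp only [Fin.sum_univ_succ, Fin.cons_zero, Fin.cons_succ, ← Finset.mul_sum, hγ]
      field_simp
      ring
    · refine Fin.cases ?_ ?_
      · simpa using he
      · simpa using hh
    · simp only [Fin.sum_univ_succ, Fin.cons_zero, Fin.cons_succ, mul_smul, ← Finset.smul_sum,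
        ← hfe]
      match_scalars <;> field_simp
      ring

end FaceDirection

section FibreNormFace

variable {E V : Type*} [AddCommGroup E] [Module ℝ E] [AddCommGroup V] [Module ℝ V]
variable (T : E →ₗ[ℝ] V) (p : Seminorm ℝ E)

lemma abs_le_mul_fibreNorm (g : V →ₗ[ℝ] ℝ) {C : ℝ} (hC : 0 ≤ C)
    (hg : ∀ e, |g (T e)| ≤ C * p e) {v : V} (hv : v ∈ LinearMap.range T) :
    |g v| ≤ C * fibreNorm T p v := by
  refine le_of_forall_pos_le_add fun ε hε => ?_
  obtain ⟨e, rfl, he⟩ := exists_lt_of_fibreNorm_lt T p hv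
    (lt_add_of_pos_right _ (show 0 < ε / (C + 1) by positivity))
  refine (hg e).trans ((mul_le_mul_of_nonneg_left he.le hC).trans ?_)
  have : C * (ε / (C + 1)) ≤ ε := by
    rw [mul_div_assoc', div_le_iff₀ (by positivity)]
    nlinarith
  linarith

/-- The face of the unit ball of the fibre norm exposed by the functional `g`. -/
def fibreFace (g : V →ₗ[ℝ] ℝ) : Set V :=
  {v | v ∈ LinearMap.range T ∧ fibreNorm T p v ≤ 1 ∧ g v = 1}

lemma convex_fibreFace (g : V →ₗ[ℝ] ℝ) : Convex ℝ (fibreFace T p g) := by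
  rintro v ⟨hv, hv1, hgv⟩ w ⟨hw, hw1, hgw⟩ a b ha hb hab
  refine ⟨add_mem (Submodule.smul_mem _ a hv) (Submodule.smul_mem _ b hw), ?_, ?_⟩
  · refine (fibreNorm_add_le T p (Submodule.smul_mem _ a hv) (Submodule.smul_mem _ b hw)).trans ?_
    rw [fibreNorm_smul T p hv, fibreNorm_smul T p hw, abs_of_nonneg ha, abs_of_nonneg hb]
    nlinarith
  · simp [hgv, hgw, hab]

variable {T p} in
lemma mem_range_of_faceDirection {g : V →ₗ[ℝ] ℝ} {f v : V} (hf : f ∈ fibreFace T p g) {ε : ℝ}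
    (hε : 0 < ε) (h : f + ε • v ∈ fibreFace T p g) : v ∈ LinearMap.range T ∧ g v = 0 := by
  constructor
  · have h1 := Submodule.sub_mem _ h.1 hf.1
    rw [add_sub_cancel_left] at h1
    exact (Submodule.smul_mem_iff _ hε.ne').1 h1
  · have h1 := h.2.2
    rw [map_add, hf.2.2, map_smul, smul_eq_mul, add_eq_left] at h1
    exact (mul_eq_zero.1 h1).resolve_left hε.ne'

lemma exitsAlongFaces_fibreFace (hpos : ∀ v ∈ LinearMap.range T, v ≠ 0 → 0 < fibreNorm T p v)
    (g : V →ₗ[ℝ] ℝ) : ExitsAlongFaces (fibreFace T p g) := by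
  rintro f hf v hv0 ⟨ε, hε, hv⟩
  have hfε := hv ε (abs_of_pos hε).le
  obtain ⟨hvR, hgv⟩ := mem_range_of_faceDirection hf hε hfε
  have hN := hpos v hvR hv0
  have hR (t : ℝ) : f + t • v ∈ LinearMap.range T := add_mem hf.1 (Submodule.smul_mem _ t hvR)
  set S : Set ℝ := {t | fibreNorm T p (f + t • v) ≤ 1}
  have hmem (t : ℝ) : f + t • v ∈ fibreFace T p g ↔ t ∈ S :=
    ⟨fun h => h.2.1, fun h => ⟨hR t, h, by simp [hgv, hf.2.2]⟩⟩
  have hlip (s t : ℝ) : fibreNorm T p (f + s • v) ≤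
      fibreNorm T p (f + t • v) + |s - t| * fibreNorm T p v := by
    rw [← fibreNorm_smul T p hvR]
    convert fibreNorm_add_le T p (hR t) (Submodule.smul_mem _ (s - t) hvR) using 2
    module
  have hbdd : BddAbove S := by
    refine ⟨2 / fibreNorm T p v, fun t ht => ?_⟩
    rw [le_div_iff₀ hN]
    have h1 := fibreNorm_add_le T p (hR t) (Submodule.smul_mem _ (-1) hf.1)
    have h2 : f + t • v + (-1 : ℝ) • f = t • v := by module
    rw [h2, fibreNorm_smul T p hvR, fibreNorm_smul T p hf.1, abs_neg, abs_one, one_mul] at h1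
    have h3 : fibreNorm T p (f + t • v) ≤ 1 := ht
    nlinarith [hf.2.1, le_abs_self t]
  have hεS : ε ∈ S := (hmem ε).1 hfε
  refine ⟨sSup S, hε.trans_le (le_csSup hbdd hεS), (hmem _).2 ?_, fun t ht h =>
    (not_le.2 ht) (le_csSup hbdd ((hmem t).1 h))⟩
  change fibreNorm T p (f + sSup S • v) ≤ 1
  refine le_of_forall_pos_le_add fun δ hδ => ?_
  obtain ⟨t, htS, ht⟩ := exists_lt_of_lt_csSup ⟨ε, hεS⟩
    (show sSup S - δ / fibreNorm T p v < sSup S by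
      have := div_pos hδ hN
      linarith)
  have h1 : fibreNorm T p (f + t • v) ≤ 1 := htS
  have h2 := hlip (sSup S) t
  rw [abs_of_nonneg (sub_nonneg.2 (le_csSup hbdd htS))] at h2
  have h3 : (sSup S - t) * fibreNorm T p v ≤ δ := by
    rw [← le_div_iff₀ hN]
    linarith
  linarith

end FibreNormFace

section NetworkDuality

variable {σ : ℝ → ℝ} {m : ℕ → ℕ} {D : ℕ} {ρ : Params m D → ℝ}
  (Kb : (Fin (m 0) → ℝ) → Fin (m D) → C₀(Params m D, ℝ))
  {M : ℕ} (x : Fin M → (Fin (m 0) → ℝ))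

/-- The map `μ ↦ f_μ` as a linear map. -/
def fMuLin : SignedMeasure (Params m D) →ₗ[ℝ] ((Fin (m 0) → ℝ) → Fin (m D) → ℝ) :=
  LinearMap.pi fun x => LinearMap.pi fun k => sIntLin (Kb x k)

lemma fMuLin_apply (μ : SignedMeasure (Params m D)) (x' : Fin (m 0) → ℝ) (k : Fin (m D)) :
    fMuLin Kb μ x' k = sIntLin (Kb x' k) μ := rfl

variable {Kb} in
lemma fMu_eq (hKb : ∀ x k θ, Kb x k θ = NNet σ m D θ x k * ρ θ)
    (μ : SignedMeasure (Params m D)) : fMu σ m D ρ μ = fMuLin Kb μ := by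
  funext x' k
  simp only [fMu, fMuLin_apply, sIntLin_apply, hKb]

variable {Kb} in
lemma BNnorm_eq (hKb : ∀ x k θ, Kb x k θ = NNet σ m D θ x k * ρ θ)
    (f : (Fin (m 0) → ℝ) → Fin (m D) → ℝ) :
    BNnorm σ m D ρ f = fibreNorm (fMuLin Kb) (tvSeminorm (Params m D)) f := by
  simp only [BNnorm, fibreNorm, fMu_eq hKb]
  rfl

variable {Kb} in
lemma mem_BNset_iff (hKb : ∀ x k θ, Kb x k θ = NNet σ m D θ x k * ρ θ)
    {f : (Fin (m 0) → ℝ) → Fin (m D) → ℝ} :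
    f ∈ BNset σ m D ρ ↔ f ∈ LinearMap.range (fMuLin Kb) := by
  simp only [BNset, Set.mem_ofPred_eq, fMu_eq hKb, LinearMap.mem_range]

/-- The kernel combination `∑ c_{kj} K_k(x_j, ·)`. -/
def kernelComb (c : Fin (m D) → Fin M → ℝ) : C₀(Params m D, ℝ) :=
  ∑ k, ∑ j, c k j • Kb (x j) k

/-- The functional `f ↦ ∑ c_{kj} f_k(x_j)`. -/
def sampleFunctional (c : Fin (m D) → Fin M → ℝ) :
    ((Fin (m 0) → ℝ) → Fin (m D) → ℝ) →ₗ[ℝ] ℝ where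
  toFun f := ∑ k, ∑ j, c k j * f (x j) k
  map_add' f g := by simp [mul_add, Finset.sum_add_distrib]
  map_smul' r f := by simp [Finset.mul_sum, mul_left_comm]

lemma sampleFunctional_apply (c : Fin (m D) → Fin M → ℝ)
    (f : (Fin (m 0) → ℝ) → Fin (m D) → ℝ) :
    sampleFunctional x c f = ∑ k, ∑ j, c k j * f (x j) k := rfl

lemma sampleFunctional_eq_dualObjective {Y : Fin (m D) → Fin M → ℝ}
    {f : (Fin (m 0) → ℝ) → Fin (m D) → ℝ} (hf : interpolates m D M x Y f)
    (c : Fin (m D) → Fin M → ℝ) : sampleFunctional x c f = dualObjective m D M Y c := by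
  simp only [sampleFunctional_apply, dualObjective, hf _ _]

lemma sIntLin_kernelComb (c : Fin (m D) → Fin M → ℝ) (μ : SignedMeasure (Params m D)) :
    sIntLin (kernelComb Kb x c) μ = sampleFunctional x c (fMuLin Kb μ) := by
  simp only [kernelComb, sampleFunctional_apply, sIntLin_sum, sIntLin_smul,
    LinearMap.sum_apply, LinearMap.smul_apply, smul_eq_mul, fMuLin_apply]

lemma abs_sampleFunctional_le (c : Fin (m D) → Fin M → ℝ)
    {f : (Fin (m 0) → ℝ) → Fin (m D) → ℝ} (hf : f ∈ LinearMap.range (fMuLin Kb)) :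
    |sampleFunctional x c f| ≤
      ‖kernelComb Kb x c‖ * fibreNorm (fMuLin Kb) (tvSeminorm (Params m D)) f := by
  refine abs_le_mul_fibreNorm _ _ _ (norm_nonneg _) (fun μ => ?_) hf
  rw [← sIntLin_kernelComb]
  exact abs_sIntLin_le _ _

lemma fibreNorm_fMuLin_pos {f : (Fin (m 0) → ℝ) → Fin (m D) → ℝ}
    (hf : f ∈ LinearMap.range (fMuLin Kb)) (h0 : f ≠ 0) :
    0 < fibreNorm (fMuLin Kb) (tvSeminorm (Params m D)) f := by
  refine lt_of_le_of_ne (fibreNorm_nonneg _ _ _) fun h => h0 ?_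
  funext x' k
  have h1 := abs_le_mul_fibreNorm (fMuLin Kb) (tvSeminorm (Params m D))
    (LinearMap.proj k ∘ₗ LinearMap.proj x') (norm_nonneg (Kb x' k))
    (fun μ => abs_sIntLin_le (Kb x' k) μ) hf
  rw [← h, mul_zero] at h1
  exact abs_nonpos_iff.1 h1

variable {Kb x} {Y c : Fin (m D) → Fin M → ℝ}

lemma kernelComb_ne_zero
    (hLI : LinearIndependent ℝ (fun p : Fin (m D) × Fin M => Kb (x p.2) p.1))
    {a : Fin (m D) → Fin M → ℝ} (ha : a ≠ 0) : kernelComb Kb x a ≠ 0 := by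
  intro h
  refine ha ?_
  have h1 := Fintype.linearIndependent_iff.1 hLI (fun p => a p.1 p.2) (by
    rw [Fintype.sum_prod_type]
    exact h)
  funext k j
  exact h1 (k, j)

lemma kernelComb_smul (r : ℝ) (a : Fin (m D) → Fin M → ℝ) :
    kernelComb Kb x (r • a) = r • kernelComb Kb x a := by
  simp [kernelComb, Finset.smul_sum, mul_smul]

lemma dualObjective_smul (r : ℝ) (a : Fin (m D) → Fin M → ℝ) :
    dualObjective m D M Y (r • a) = r * dualObjective m D M Y a := by
  simp [dualObjective, Finset.mul_sum, mul_assoc]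

lemma dualObjective_le
    (hLI : LinearIndependent ℝ (fun p : Fin (m D) × Fin M => Kb (x p.2) p.1))
    (hc : dualSolves m D Kb M x Y c) (a : Fin (m D) → Fin M → ℝ) :
    dualObjective m D M Y a ≤ ‖kernelComb Kb x a‖ * dualObjective m D M Y c := by
  rcases eq_or_ne a 0 with rfl | ha
  · simp [dualObjective, kernelComb]
  have hpos := norm_pos_iff.2 (kernelComb_ne_zero hLI ha)
  have h := hc.2 (‖kernelComb Kb x a‖⁻¹ • a) (by
    change ‖kernelComb Kb x _‖ = 1
    rw [kernelComb_smul, norm_smul, norm_inv, norm_norm, inv_mul_cancel₀ hpos.ne'])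
  rwa [dualObjective_smul, inv_mul_le_iff₀ hpos] at h

lemma dualObjective_pos (hY : Y ≠ 0)
    (hLI : LinearIndependent ℝ (fun p : Fin (m D) × Fin M => Kb (x p.2) p.1))
    (hc : dualSolves m D Kb M x Y c) : 0 < dualObjective m D M Y c := by
  have h1 : 0 < dualObjective m D M Y Y := by
    obtain ⟨k, hk⟩ := Function.ne_iff.1 hY
    obtain ⟨j, hj⟩ := Function.ne_iff.1 hk
    refine Finset.sum_pos' (fun _ _ => Finset.sum_nonneg fun _ _ => mul_self_nonneg _)
      ⟨k, Finset.mem_univ _, Finset.sum_pos' (fun _ _ => mul_self_nonneg _)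
        ⟨j, Finset.mem_univ _, mul_self_pos.2 hj⟩⟩
  exact pos_of_mul_pos_right (h1.trans_le (dualObjective_le hLI hc Y)) (norm_nonneg _)

/-- Strong duality: the value of the MNI problem is at most the dual value. -/
lemma exists_interpolates_tvNorm_lt
    (hLI : LinearIndependent ℝ (fun p : Fin (m D) × Fin M => Kb (x p.2) p.1))
    (hY : Y ≠ 0) (hc : dualSolves m D Kb M x Y c) {μ : SignedMeasure (Params m D)}
    (hμ : interpolates m D M x Y (fMuLin Kb μ)) {r : ℝ} (hr : dualObjective m D M Y c < r) :
    ∃ ν : SignedMeasure (Params m D), interpolates m D M x Y (fMuLin Kb ν) ∧ tvNorm ν < r := by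
  let L : Fin (m D) × Fin M → SignedMeasure (Params m D) →ₗ[ℝ] ℝ :=
    fun q => sIntLin (Kb (x q.2) q.1)
  obtain ⟨g, hgμ, hle, hker⟩ := exists_dual_fibreNorm (LinearMap.pi L)
    (tvSeminorm (Params m D)) μ
  rw [LinearMap.ker_pi] at hker
  obtain ⟨a, ha⟩ := (Submodule.mem_span_range_iff_exists_fun ℝ).1
    (mem_span_of_iInf_ker_le_ker hker)
  let a' : Fin (m D) → Fin M → ℝ := fun k j => a (k, j)
  have hg : g = sIntLin (kernelComb Kb x a') := by
    rw [← ha, Fintype.sum_prod_type]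
    simp only [kernelComb, sIntLin_sum, sIntLin_smul, a', L]
  have hnorm : ‖kernelComb Kb x a'‖ ≤ 1 := by
    refine (BoundedContinuousFunction.norm_le (f := (kernelComb Kb x a').toBCF) zero_le_one).2
      fun θ => ?_
    change |kernelComb Kb x a' θ| ≤ 1
    have h1 := (hle (Measure.dirac θ).toSignedMeasure).trans (tvNorm_dirac_le θ)
    have h2 := (hle (-(Measure.dirac θ).toSignedMeasure)).trans
      ((map_neg_eq_map (tvSeminorm _) _).trans_le (tvNorm_dirac_le θ))
    rw [map_neg] at h2
    rw [hg, sIntLin_dirac] at h1 h2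
    exact abs_le.2 ⟨by linarith, h1⟩
  have hlt : fibreNorm (LinearMap.pi L) (tvSeminorm (Params m D)) (LinearMap.pi L μ) < r := by
    refine lt_of_le_of_lt ?_ hr
    rw [← hgμ, hg, sIntLin_kernelComb, sampleFunctional_eq_dualObjective x hμ]
    have h1 := dualObjective_le hLI hc a'
    have h2 := dualObjective_pos hY hLI hc
    nlinarith
  obtain ⟨ν, hν, hlt⟩ := exists_lt_of_fibreNorm_lt _ _ ⟨μ, rfl⟩ hlt
  refine ⟨ν, fun j k => ?_, hlt⟩
  rw [← hμ j k]
  exact congrFun hν (k, j)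

lemma BNnorm_eq_dualObjective (hKb : ∀ x k θ, Kb x k θ = NNet σ m D θ x k * ρ θ)
    (hLI : LinearIndependent ℝ (fun p : Fin (m D) × Fin M => Kb (x p.2) p.1))
    (hY : Y ≠ 0) (hc : dualSolves m D Kb M x Y c)
    {f : (Fin (m 0) → ℝ) → Fin (m D) → ℝ} (hf : f ∈ MNISolSet σ m D ρ M x Y) :
    BNnorm σ m D ρ f = dualObjective m D M Y c := by
  obtain ⟨hfB, hfI, hmin⟩ := hf
  rw [mem_BNset_iff hKb] at hfB
  refine le_antisymm (le_of_forall_gt fun r hr => ?_) ?_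
  · obtain ⟨μ, rfl⟩ := hfB
    obtain ⟨ν, hν, hlt⟩ := exists_interpolates_tvNorm_lt hLI hY hc hfI hr
    have h := hmin ν (by rwa [fMu_eq hKb])
    rw [fMu_eq hKb ν, BNnorm_eq hKb (fMuLin Kb ν)] at h
    exact (h.trans (fibreNorm_le (fMuLin Kb) (tvSeminorm (Params m D)) ν)).trans_lt hlt
  · have h := abs_sampleFunctional_le Kb x c hfB
    rw [show ‖kernelComb Kb x c‖ = 1 from hc.1, one_mul, sampleFunctional_eq_dualObjective x hfI,
      ← BNnorm_eq hKb] at h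
    exact (le_abs_self _).trans h

lemma norm_ghat (hY : Y ≠ 0)
    (hLI : LinearIndependent ℝ (fun p : Fin (m D) × Fin M => Kb (x p.2) p.1))
    (hc : dualSolves m D Kb M x Y c) : ‖ghat m D Kb M x Y c‖ = dualObjective m D M Y c := by
  rw [ghat, norm_smul, show ‖∑ k, ∑ j, c k j • Kb (x j) k‖ = 1 from hc.1, mul_one,
    Real.norm_of_nonneg (dualObjective_pos hY hLI hc).le]

lemma subdiffSup_ghat_eq (hKb : ∀ x k θ, Kb x k θ = NNet σ m D θ x k * ρ θ)
    (hLI : LinearIndependent ℝ (fun p : Fin (m D) × Fin M => Kb (x p.2) p.1))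
    (hY : Y ≠ 0) (hc : dualSolves m D Kb M x Y c) :
    subdiffSup σ m D ρ (ghat m D Kb M x Y c) =
      fibreFace (fMuLin Kb) (tvSeminorm (Params m D)) (sampleFunctional x c) := by
  have hpos := dualObjective_pos hY hLI hc
  have hpair (μ : SignedMeasure (Params m D)) :
      sInt μ (fun θ => ghat m D Kb M x Y c θ) =
        dualObjective m D M Y c * sampleFunctional x c (fMuLin Kb μ) := by
    rw [← sIntLin_kernelComb, ← smul_eq_mul, ← LinearMap.smul_apply, ← sIntLin_smul]
    rfl
  ext f
  simp only [subdiffSup, fibreFace, Set.mem_ofPred_eq, mem_BNset_iff hKb, BNnorm_eq hKb,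
    fMu_eq hKb, norm_ghat hY hLI hc, hpair]
  constructor
  · rintro ⟨hf, h1, h2⟩
    refine ⟨hf, h1.le, ?_⟩
    obtain ⟨μ, rfl⟩ := hf
    exact (mul_eq_left₀ hpos.ne').1 (h2 μ rfl)
  · rintro ⟨hf, h1, h2⟩
    refine ⟨hf, le_antisymm h1 ?_, ?_⟩
    · have h := abs_sampleFunctional_le Kb x c hf
      rwa [h2, abs_one, show ‖kernelComb Kb x c‖ = 1 from hc.1, one_mul] at h
    · rintro μ rfl
      rw [h2, mul_one]

/-- The face of `C*⁻¹ f` in the subdifferential has dimension less than the number of data, when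
`f` is an extreme point of the solution set. -/
lemma finrank_faceDirection_lt (hKb : ∀ x k θ, Kb x k θ = NNet σ m D θ x k * ρ θ)
    (hLI : LinearIndependent ℝ (fun p : Fin (m D) × Fin M => Kb (x p.2) p.1))
    (hY : Y ≠ 0) (hc : dualSolves m D Kb M x Y c)
    {f : (Fin (m 0) → ℝ) → Fin (m D) → ℝ} (hf : f ∈ (MNISolSet σ m D ρ M x Y).extremePoints ℝ)
    (hface : (dualObjective m D M Y c)⁻¹ • f ∈
      fibreFace (fMuLin Kb) (tvSeminorm (Params m D)) (sampleFunctional x c)) :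
    FiniteDimensional ℝ (faceDirection (convex_fibreFace _ _ _) hface) ∧
      Module.finrank ℝ (faceDirection (convex_fibreFace _ _ _) hface) < m D * M := by
  set W := faceDirection (convex_fibreFace _ _ _) hface
  set C := dualObjective m D M Y c with hC
  have hCpos : 0 < C := dualObjective_pos hY hLI hc
  let φ : (Fin (m D) × Fin M → ℝ) →ₗ[ℝ] ℝ := ∑ q, c q.1 q.2 • LinearMap.proj q
  let ev : W →ₗ[ℝ] (Fin (m D) × Fin M → ℝ) :=
    (LinearMap.pi fun q => LinearMap.proj q.1 ∘ₗ LinearMap.proj (x q.2)) ∘ₗ W.subtype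
  have hφ : φ ≠ 0 := by
    intro h0
    have hc0 : c = 0 := by
      funext k j
      have := LinearMap.congr_fun h0 (Pi.single (k, j) 1)
      simpa [φ, LinearMap.sum_apply, Pi.single_apply] using this
    rw [hC, hc0] at hCpos
    simp [dualObjective] at hCpos
  have hrange : LinearMap.range ev ≤ LinearMap.ker φ := by
    rintro _ ⟨⟨v, ε, hε, hv⟩, rfl⟩
    have h := (mem_range_of_faceDirection hface hε (hv ε (abs_of_pos hε).le)).2
    rw [sampleFunctional_apply, ← Fintype.sum_prod_type'] at h
    simpa [φ, ev, LinearMap.sum_apply] using h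
  have hinj : Function.Injective ev := by
    rw [← LinearMap.ker_eq_bot, LinearMap.ker_eq_bot']
    rintro ⟨v, ε, hε, hv⟩ h0
    have hv0 (j : Fin M) (k : Fin (m D)) : v (x j) k = 0 := congrFun h0 (k, j)
    have hsol (t : ℝ) (ht : |t| ≤ ε) : f + (C * t) • v ∈ MNISolSet σ m D ρ M x Y := by
      obtain ⟨h1, h2, -⟩ := hv t ht
      have heq : f + (C * t) • v = C • (C⁻¹ • f + t • v) := by
        rw [smul_add, smul_inv_smul₀ hCpos.ne', mul_smul]
      refine ⟨?_, fun j k => ?_, fun ν hν => ?_⟩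
      · rw [mem_BNset_iff hKb, heq]
        exact Submodule.smul_mem _ _ h1
      · simpa [hv0] using hf.1.2.1 j k
      · refine le_trans ?_ (hf.1.2.2 ν hν)
        rw [BNnorm_eq_dualObjective hKb hLI hY hc hf.1, BNnorm_eq hKb, heq,
          fibreNorm_smul _ _ h1, abs_of_pos hCpos]
        exact mul_le_of_le_one_right hCpos.le h2
    have hext := hf.2 (hsol ε (abs_of_pos hε).le) (hsol (-ε) (by rw [abs_neg, abs_of_pos hε]))
      ⟨1 / 2, 1 / 2, by norm_num, by norm_num, by norm_num, by module⟩
    rw [add_eq_left] at hext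
    exact Subtype.ext ((smul_eq_zero.1 hext).resolve_left (by positivity))
  have hfin : FiniteDimensional ℝ W := FiniteDimensional.of_injective ev hinj
  refine ⟨hfin, ?_⟩
  rw [← LinearMap.finrank_range_of_inj hinj]
  have hlt : LinearMap.range ev < ⊤ := by
    refine lt_of_le_of_lt hrange (lt_top_iff_ne_top.2 fun h => hφ ?_)
    exact LinearMap.ker_eq_top.1 h
  refine (Submodule.finrank_lt hlt.ne).trans_eq ?_
  simp

end NetworkDuality

/-- Let `ĉ` solve the dual problem, let `C*` be its optimal value and
`ĝ := C*·∑_{k,j} ĉ_{kj} K_k(x_j,·)`.  Then every extreme point `f̂` of the solution set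
`S_{X,Y}` of the MNI problem is of the form `f̂ = ∑_{ℓ=1}^{tm} γ_ℓ h_ℓ` with
`∑ γ_ℓ = ‖ĝ‖_∞` and `h_ℓ ∈ ext(∂‖·‖_∞(ĝ))`. -/
theorem statement_13
    (σ : ℝ → ℝ) (hσ : Continuous σ) (m : ℕ → ℕ) (D : ℕ) (hD : 0 < D)
    (ρ : Params m D → ℝ) (hρc : Continuous ρ) (hρpos : ∀ θ, 0 < ρ θ)
    (Kb : (Fin (m 0) → ℝ) → Fin (m D) → C₀(Params m D, ℝ))
    (hKb : ∀ x k θ, Kb x k θ = NNet σ m D θ x k * ρ θ)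
    (M : ℕ) (x : Fin M → (Fin (m 0) → ℝ)) (hx : Function.Injective x)
    (Y : Fin (m D) → Fin M → ℝ) (hY : Y ≠ 0)
    (hLI : LinearIndependent ℝ (fun p : Fin (m D) × Fin M => Kb (x p.2) p.1))
    (c : Fin (m D) → Fin M → ℝ) (hc : dualSolves m D Kb M x Y c) :
    ∀ f ∈ Set.extremePoints ℝ (MNISolSet σ m D ρ M x Y),
      ∃ (γ : Fin (m D * M) → ℝ)
        (h : Fin (m D * M) → ((Fin (m 0) → ℝ) → Fin (m D) → ℝ)),
        (∑ ℓ, γ ℓ) = ‖ghat m D Kb M x Y c‖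
        ∧ (∀ ℓ, h ℓ ∈ Set.extremePoints ℝ (subdiffSup σ m D ρ (ghat m D Kb M x Y c)))
        ∧ ∀ (x' : Fin (m 0) → ℝ) (k : Fin (m D)), f x' k = ∑ ℓ, γ ℓ * h ℓ x' k := by
  intro f hf
  have hpos := dualObjective_pos hY hLI hc
  have hface : (dualObjective m D M Y c)⁻¹ • f ∈
      fibreFace (fMuLin Kb) (tvSeminorm (Params m D)) (sampleFunctional x c) := by
    have hfB := (mem_BNset_iff hKb).1 hf.1.1
    refine ⟨Submodule.smul_mem _ _ hfB, ?_, ?_⟩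
    · rw [fibreNorm_smul _ _ hfB, ← BNnorm_eq hKb, BNnorm_eq_dualObjective hKb hLI hY hc hf.1,
        abs_of_pos (inv_pos.2 hpos), inv_mul_cancel₀ hpos.ne']
    · rw [map_smul, sampleFunctional_eq_dualObjective x hf.1.2.1, smul_eq_mul,
        inv_mul_cancel₀ hpos.ne']
  obtain ⟨hfin, hlt⟩ := finrank_faceDirection_lt hKb hLI hY hc hf hface
  obtain ⟨n, hn⟩ : ∃ n, m D * M = n + 1 := ⟨m D * M - 1, by omega⟩
  obtain ⟨γ, h, hγ, hh, hsum⟩ := exists_affine_combination_extremePoints _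
    (exitsAlongFaces_fibreFace _ _ (fun v hv hv0 => fibreNorm_fMuLin_pos Kb hv hv0) _) n _ hface
    hfin (by omega)
  rw [subdiffSup_ghat_eq hKb hLI hY hc, norm_ghat hY hLI hc, hn]
  refine ⟨fun ℓ => dualObjective m D M Y c * γ ℓ, h, ?_, hh, fun x' k => ?_⟩
  · rw [← Finset.mul_sum, hγ, mul_one]
  · rw [inv_smul_eq_iff₀ hpos.ne'] at hsum
    rw [hsum]
    simp [Finset.sum_apply, Finset.mul_sum, mul_assoc]

end
end

section
/- Suppose m distinct points x_1,…,x_m ∈ ℝ^s and Y = [y_j^k] ∈ ℝ^{t×m} with Y ≠ 0 are given, and the functions K_k(x_j,·), j ∈ {1,…,m}, k ∈ {1,…,t}, are linearly independent in C₀(Θ). If μ̂ ∈ M(Θ) is a solution of the measure MNI problem inf{‖μ‖_TV : μ ∈ M(Θ), ∫_Θ K_k(x_j,θ) dμ(θ) = y_j^k for all j ∈ {1,…,m}, k ∈ {1,…,t}}, then f_{μ̂} is a solution of the MNI problem inf{‖f_μ‖_{B_N} : f_μ ∈ B_N, f_μ(x_j) = y_j for all j}, and ‖f_{μ̂}‖_{B_N}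 = ‖μ̂‖_TV. -/
open MeasureTheory Filter Topology
open scoped ZeroAtInfty BigOperators

noncomputable section

theorem BNnorm_fMu_le (σ : ℝ → ℝ) (m : ℕ → ℕ) (D : ℕ) (ρ : Params m D → ℝ)
    (μ : SignedMeasure (Params m D)) :
    BNnorm σ m D ρ (fMu σ m D ρ μ) ≤ tvNorm μ := by
  refine csInf_le ⟨0, ?_⟩ ⟨μ, rfl, rfl⟩
  rintro _ ⟨ν, -, rfl⟩
  exact ENNReal.toReal_nonneg

/-- If `μ̂` solves the measure MNI problem
`inf {‖μ‖_TV : ∫_Θ K_k(x_j,θ) dμ(θ) = y_j^k}`, then `f_{μ̂}` solves the MNI problem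
`inf {‖f‖_{B_N} : f ∈ B_N, f(x_j) = y_j}` and `‖f_{μ̂}‖_{B_N} = ‖μ̂‖_TV`. -/
theorem statement_14
    (σ : ℝ → ℝ) (hσ : Continuous σ) (m : ℕ → ℕ) (D : ℕ) (hD : 0 < D)
    (ρ : Params m D → ℝ) (hρc : Continuous ρ) (hρpos : ∀ θ, 0 < ρ θ)
    (Kb : (Fin (m 0) → ℝ) → Fin (m D) → C₀(Params m D, ℝ))
    (hKb : ∀ x k θ, Kb x k θ = NNet σ m D θ x k * ρ θ)
    (M : ℕ) (x : Fin M → (Fin (m 0) → ℝ)) (hx : Function.Injective x)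
    (Y : Fin (m D) → Fin M → ℝ) (hY : Y ≠ 0)
    (hLI : LinearIndependent ℝ (fun p : Fin (m D) × Fin M => Kb (x p.2) p.1))
    (μhat : SignedMeasure (Params m D)) (hμ : μhat ∈ MeasSolSet σ m D ρ M x Y) :
    fMu σ m D ρ μhat ∈ MNISolSet σ m D ρ M x Y
      ∧ BNnorm σ m D ρ (fMu σ m D ρ μhat) = tvNorm μhat := by
  obtain ⟨hint, hmin⟩ := hμ
  have lower : ∀ ν : SignedMeasure (Params m D),
      interpolates m D M x Y (fMu σ m D ρ ν) →
        tvNorm μhat ≤ BNnorm σ m D ρ (fMu σ m D ρ ν) := by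
    intro ν hν
    refine le_csInf ⟨_, ν, rfl, rfl⟩ ?_
    rintro _ ⟨ν', hν', rfl⟩
    exact hmin ν' (hν'.symm ▸ hν)
  have norm_eq : BNnorm σ m D ρ (fMu σ m D ρ μhat) = tvNorm μhat :=
    le_antisymm (BNnorm_fMu_le σ m D ρ μhat) (lower μhat hint)
  exact ⟨⟨⟨μhat, rfl⟩, hint, fun ν hν => norm_eq.trans_le (lower ν hν)⟩, norm_eq⟩

end
end

section
/- Suppose m distinct points x_1,…,x_m ∈ ℝ^s and Y = [y_j^k] ∈ ℝ^{t×m} with Y ≠ 0 are given, and the functions K_k(x_j,·), j ∈ {1,…,m}, k ∈ {1,…,t}, are linearly independent in C₀(Θ). Let ĉ ∈ ℝ^{t×m} be a solution of the dual problem, C* its optimal value, and ĝ(θ) := C*·Σ_{k=1}^t Σ_{j=1}^m ĉ_{kj} K_k(x_j,θ). Then the MNI problem inf{‖f_μ‖_{B_N} : f_μ ∈ B_N, f_μ(x_j) = y_j for all j} has a solution f̂ of the form f̂(x) = Σ_{ℓ=1}^{tm} γ_ℓ · sign(ĝ(θ_ℓ)) · K(x, θ_ℓ) for all x ∈ ℝ^s,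 for some γ_1,…,γ_{tm} ∈ ℝ with Σ_{ℓ=1}^{tm} γ_ℓ = ‖ĝ‖_∞ and some θ_1,…,θ_{tm} ∈ Θ(ĝ). -/
open MeasureTheory Filter Topology
open scoped ZeroAtInfty BigOperators

noncomputable section

/-- A sum of weighted vectors can be re-indexed by a larger `Fin n`, padding by zero weights. -/
lemma exists_fin_padding {ι α : Type*} [Fintype ι] [Nonempty ι] {n : ℕ}
    (hn : Fintype.card ι ≤ n) (w : ι → ℝ) (z : ι → α) :
    ∃ (w' : Fin n → ℝ) (z' : Fin n → α), ((∀ i, 0 ≤ w i) → ∀ i, 0 ≤ w' i) ∧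
      (∀ i, ∃ j, z' i = z j) ∧ ∀ {E : Type} [AddCommGroup E] [Module ℝ E] (F : α → E),
        ∑ i, w' i • F (z' i) = ∑ i, w i • F (z i) := by
  obtain ⟨e⟩ : Nonempty (ι ↪ Fin n) :=
    Function.Embedding.nonempty_of_card_le (by simpa using hn)
  obtain ⟨i₀⟩ := ‹Nonempty ι›
  refine ⟨Function.extend e w 0, fun i => z (Function.extend e id (fun _ => i₀) i),
    fun hw i => ?_, fun i => ⟨_, rfl⟩, fun F => ?_⟩
  · by_cases h : ∃ j, e j = i
    · obtain ⟨j, rfl⟩ := h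
      rw [e.injective.extend_apply]
      exact hw j
    · rw [Function.extend_apply' _ _ _ h]
      rfl
  · refine (Fintype.sum_of_injective e e.injective _ _ (fun i hi => ?_) fun i => ?_).symm
    · rw [Function.extend_apply' _ _ _ (by simpa using hi)]
      simp
    · simp only [e.injective.extend_apply, id]

/-- In a finite dimensional space, the convex hull of a compact set is compact. -/
lemma isCompact_convexHull_of_finiteDimensional {E : Type} [AddCommGroup E] [Module ℝ E]
    [TopologicalSpace E] [ContinuousAdd E] [ContinuousSMul ℝ E] [FiniteDimensional ℝ E]
    {s : Set E} (hs : IsCompact s) : IsCompact (convexHull ℝ s) := by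
  set n := Module.finrank ℝ E + 1
  let T : Set ((Fin n → ℝ) × (Fin n → E)) := stdSimplex ℝ (Fin n) ×ˢ Set.univ.pi fun _ => s
  have hT : IsCompact T := (isCompact_stdSimplex ℝ (Fin n)).prod (isCompact_univ_pi fun _ => hs)
  have himage : convexHull ℝ s = (fun p => ∑ i, p.1 i • p.2 i) '' T := by
    apply Set.Subset.antisymm
    · intro x hx
      obtain ⟨ι, _, z, w, hz, hind, hw, hw1, rfl⟩ := eq_pos_convex_span_of_mem_convexHull hx
      have : Nonempty ι := by
        by_contra h
        rw [not_nonempty_iff] at h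
        simp at hw1
      have hcard : Fintype.card ι ≤ n := hind.card_le_finrank_succ.trans
        (Nat.succ_le_succ (Submodule.finrank_le _))
      obtain ⟨w', z', hw', hz', hsum⟩ := exists_fin_padding hcard w z
      refine ⟨(w', z'), ⟨⟨hw' fun i => (hw i).le, ?_⟩, fun i _ => ?_⟩, hsum id⟩
      · simpa [hw1] using hsum (fun _ => (1 : ℝ))
      · obtain ⟨j, hj⟩ := hz' i
        change z' i ∈ s
        rw [hj]
        exact hz (Set.mem_range_self j)
    · rintro _ ⟨⟨w, z⟩, ⟨⟨hw, hw1⟩, hz⟩, rfl⟩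
      exact (convex_convexHull ℝ s).sum_mem (fun i _ => hw i) hw1
        fun i _ => subset_convexHull ℝ s (hz i trivial)
  rw [himage]
  exact hT.image (by fun_prop)

lemma ZeroAtInftyContinuousMap.sum_smul_apply {Θ I : Type*} [TopologicalSpace Θ] [Fintype I]
    (v : I → C₀(Θ, ℝ)) (d : I → ℝ) (θ : Θ) : (∑ p, d p • v p) θ = ∑ p, d p * v p θ := by
  let φ : C₀(Θ, ℝ) →+ ℝ :=
    { toFun := fun f => f θ, map_zero' := rfl, map_add' := fun _ _ => rfl }
  exact map_sum φ _ _

/-- A point lying in `C` times the polar of the dual constraint set is `C` times a convex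
combination of at most `card I` signed evaluations at points where the extremal function `g`
attains its norm. -/
lemma exists_extremal_convex_combination {Θ I : Type} [TopologicalSpace Θ] [Fintype I]
    {n : ℕ} (hn : Fintype.card I = n) (v : I → C₀(Θ, ℝ)) (y c : I → ℝ) {C : ℝ} (hC : 0 < C)
    (hcy : ∑ p, c p * y p = C) (hg : ‖∑ p, c p • v p‖ = 1)
    (hle : ∀ d : I → ℝ, ∑ p, d p * y p ≤ C * ‖∑ p, d p • v p‖) :
    ∃ (w : Fin n → ℝ) (θ : Fin n → Θ), (∀ i, 0 ≤ w i) ∧ ∑ i, w i = 1 ∧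
      (∀ i, |(∑ p, c p • v p) (θ i)| = 1) ∧
      ∀ p, ∑ i, w i * (Real.sign ((∑ p, c p • v p) (θ i)) * v p (θ i)) = y p / C := by
  classical
  have heval := ZeroAtInftyContinuousMap.sum_smul_apply v
  have hnorm : ∀ (f : C₀(Θ, ℝ)) θ, |f θ| ≤ ‖f‖ := fun f θ => f.toBCF.norm_coe_le_norm θ
  let u : Θ → I → ℝ := fun θ p => v p θ
  have hu : Continuous u := continuous_pi fun p => (v p).continuous
  have hu0 : Tendsto u (cocompact Θ) (𝓝 0) := tendsto_pi_nhds.2 fun p => (v p).zero_at_infty'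
  have hA := hu0.isCompact_insert_range_of_cocompact hu
  set A := insert 0 (Set.range u)
  have hB := isCompact_convexHull_of_finiteDimensional (hA.union hA.neg)
  have hbound : ∀ (d : I → ℝ), ∀ a ∈ A ∪ -A, ∑ p, d p * a p ≤ ‖∑ p, d p • v p‖ := by
    have key : ∀ (d : I → ℝ), ∀ a ∈ A, |∑ p, d p * a p| ≤ ‖∑ p, d p • v p‖ := by
      rintro d a (rfl | ⟨θ, rfl⟩)
      · simp
      · exact heval d θ ▸ hnorm _ θ
    rintro d a (ha | ha)
    · exact (le_abs_self _).trans (key d a ha)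
    · have := (neg_le_abs _).trans (key d (-a) ha)
      simpa using this
  have hmem : C⁻¹ • y ∈ convexHull ℝ (A ∪ -A) := by
    by_contra hnot
    obtain ⟨f, r, hf, hr⟩ := geometric_hahn_banach_closed_point (convex_convexHull ℝ _)
      hB.isClosed hnot
    have hfe : ∀ a : I → ℝ, f a = ∑ p, f (Pi.single p 1) * a p := by
      intro a
      have h := congrArg f (pi_eq_sum_univ' a)
      simpa [map_sum, mul_comm, Pi.single_apply, eq_comm, Pi.single, Function.update] using h
    set d : I → ℝ := fun p => f (Pi.single p 1)
    have hr0 : 0 < r := by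
      have := hf 0 (subset_convexHull ℝ _ (Or.inl (Set.mem_insert _ _)))
      simpa using this
    have hdr : ‖∑ p, d p • v p‖ ≤ r := by
      rw [← ZeroAtInftyContinuousMap.norm_toBCF_eq_norm]
      refine (BoundedContinuousFunction.norm_le hr0.le).2 fun θ => abs_le.2 ?_
      have h1 := hf (u θ) (subset_convexHull ℝ _ (Or.inl (Or.inr ⟨θ, rfl⟩)))
      have h2 := hf (-u θ) (subset_convexHull ℝ _ (Or.inr (by simp [A])))
      rw [map_neg] at h2
      rw [hfe] at h1 h2
      have h3 : (∑ p, d p • v p).toBCF θ = ∑ p, d p * u θ p := heval d θ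
      rw [h3]
      constructor <;> linarith
    have h4 : r < C⁻¹ * ∑ p, d p * y p := by
      rw [map_smul, hfe] at hr
      exact hr
    have h5 := hle d
    rw [inv_mul_eq_div, lt_div_iff₀ hC] at h4
    nlinarith
  obtain ⟨ι, _, z, w, hz, hind, hw, hw1, hwz⟩ := eq_pos_convex_span_of_mem_convexHull hmem
  have : Nonempty ι := by
    by_contra h
    rw [not_nonempty_iff] at h
    simp at hw1
  let L : (I → ℝ) →ₗ[ℝ] ℝ := ∑ p, c p • LinearMap.proj p
  have hL : ∀ a, L a = ∑ p, c p * a p := fun a => by simp [L]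
  have hLle : ∀ i, L (z i) ≤ 1 := fun i => by
    rw [hL, ← hg]
    exact hbound c _ (hz (Set.mem_range_self i))
  have hLsum : ∑ i, w i * L (z i) = 1 := by
    have h := congrArg L hwz
    simp only [map_sum, map_smul, smul_eq_mul, hL y, hcy] at h
    rw [h, inv_mul_cancel₀ hC.ne']
  have hLz : ∀ i, L (z i) = 1 := by
    have h0 : ∑ i, w i * (1 - L (z i)) = 0 := by
      simp [mul_sub, hLsum, hw1]
    intro i
    have := (Finset.sum_eq_zero_iff_of_nonneg
      (fun i _ => mul_nonneg (hw i).le (sub_nonneg.2 (hLle i)))).1 h0 i (Finset.mem_univ i)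
    have := (mul_eq_zero.1 this).resolve_left (hw i).ne'
    linarith
  have hlin : LinearIndependent ℝ z := by
    rw [Fintype.linearIndependent_iff]
    intro a ha
    have hsum : ∑ i, a i = 0 := by
      have h := congrArg L ha
      simpa [map_sum, hLz] using h
    have := affineIndependent_iff.1 hind Finset.univ a hsum ha
    exact fun i => this i (Finset.mem_univ i)
  have hcard : Fintype.card ι ≤ n := by
    simpa [hn] using hlin.fintype_card_le_finrank
  have hpt : ∀ i, ∃ θ, |(∑ p, c p • v p) θ| = 1 ∧
      z i = Real.sign ((∑ p, c p • v p) θ) • u θ := by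
    intro i
    have hLi := hLz i
    rw [hL] at hLi
    rcases hz (Set.mem_range_self i) with (h | ⟨θ, hθ⟩) | (h | ⟨θ, hθ⟩)
    · simp [h] at hLi
    · have h1 : (∑ p, c p • v p) θ = 1 := by
        rw [heval, ← hLi, ← hθ]
      exact ⟨θ, by simp [h1], by simp [h1, hθ]⟩
    · simp [neg_eq_zero.1 h] at hLi
    · have h1 : (∑ p, c p • v p) θ = -1 := by
        have h2 : z i = -u θ := by rw [hθ, neg_neg]
        rw [heval, ← hLi, h2]
        simp [u]
      refine ⟨θ, by simp [h1], ?_⟩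
      rw [h1, hθ, Real.sign_of_neg (by norm_num)]
      simp
  choose θ hθ1 hθ2 using hpt
  obtain ⟨w', θ', hw', hθ', hsum⟩ := exists_fin_padding hcard w θ
  refine ⟨w', θ', hw' fun i => (hw i).le, ?_, fun i => ?_, fun p => ?_⟩
  · simpa [hw1] using hsum (fun _ => (1 : ℝ))
  · obtain ⟨j, hj⟩ := hθ' i
    rw [hj, hθ1]
  · have h1 := congrFun hwz p
    have h2 := hsum fun θ => Real.sign ((∑ p, c p • v p) θ) * v p θ
    simp only [smul_eq_mul] at h2
    rw [h2, div_eq_inv_mul]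
    simpa [hθ2, u] using h1

/-- Cross-adding the Jordan decomposition of a difference of finite measures with that
difference gives an equality of measures. -/
lemma posPart_add_eq_negPart_add_s16 {Θ : Type*} [MeasurableSpace Θ] (P N : Measure Θ)
    [IsFiniteMeasure P] [IsFiniteMeasure N] :
    (P.toSignedMeasure - N.toSignedMeasure).toJordanDecomposition.posPart + N =
      (P.toSignedMeasure - N.toSignedMeasure).toJordanDecomposition.negPart + P := by
  set j := (P.toSignedMeasure - N.toSignedMeasure).toJordanDecomposition with hj
  have hs : j.toSignedMeasure = P.toSignedMeasure - N.toSignedMeasure :=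
    SignedMeasure.toSignedMeasure_toJordanDecomposition _
  ext A hA
  have h := congrArg (fun s : SignedMeasure Θ => s A) hs
  simp only [JordanDecomposition.toSignedMeasure, Measure.toSignedMeasure_sub_apply hA] at h
  rw [← ENNReal.toReal_eq_toReal_iff' (measure_ne_top _ _) (measure_ne_top _ _)]
  change (j.posPart + N).real A = (j.negPart + P).real A
  rw [measureReal_add_apply, measureReal_add_apply]
  linarith

/-- The integral against a signed measure can be computed from any decomposition as a difference
of finite measures. -/
lemma sInt_toSignedMeasure_sub {Θ : Type*} [MeasurableSpace Θ] (P N : Measure Θ)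
    [IsFiniteMeasure P] [IsFiniteMeasure N] {f : Θ → ℝ}
    (hf : ∀ μ : Measure Θ, IsFiniteMeasure μ → Integrable f μ) :
    sInt (P.toSignedMeasure - N.toSignedMeasure) f = ∫ θ, f θ ∂P - ∫ θ, f θ ∂N := by
  have h := congrArg (fun μ => ∫ θ, f θ ∂μ) (posPart_add_eq_negPart_add_s16 P N)
  rw [integral_add_measure (hf _ inferInstance) (hf _ inferInstance),
    integral_add_measure (hf _ inferInstance) (hf _ inferInstance)] at h
  rw [sInt]
  linarith

/-- The Jordan decomposition minimizes the total mass among decompositions of a signed measure as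
a difference of finite measures. -/
lemma tvNorm_toSignedMeasure_sub_le {Θ : Type*} [MeasurableSpace Θ] (P N : Measure Θ)
    [IsFiniteMeasure P] [IsFiniteMeasure N] :
    tvNorm (P.toSignedMeasure - N.toSignedMeasure) ≤ P.real Set.univ + N.real Set.univ := by
  have h := posPart_add_eq_negPart_add_s16 P N
  rw [tvNorm, SignedMeasure.totalVariation]
  set j := (P.toSignedMeasure - N.toSignedMeasure).toJordanDecomposition
  obtain ⟨S, -, hpos, hneg⟩ := j.mutuallySingular
  have hP : j.posPart Set.univ ≤ P Set.univ := by
    have h1 := congrArg (fun μ : Measure Θ => μ Sᶜ) h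
    simp only [Measure.add_apply, hneg, zero_add] at h1
    calc j.posPart Set.univ ≤ j.posPart S + j.posPart Sᶜ := by
          rw [← Set.union_compl_self S]
          exact measure_union_le _ _
      _ ≤ P Sᶜ := by
          rw [hpos, zero_add, ← h1]
          exact le_self_add
      _ ≤ P Set.univ := measure_mono (Set.subset_univ _)
  have hN : j.negPart Set.univ ≤ N Set.univ := by
    have h1 := congrArg (fun μ : Measure Θ => μ S) h
    simp only [Measure.add_apply, hpos, zero_add] at h1
    calc j.negPart Set.univ ≤ j.negPart S + j.negPart Sᶜ := by
          rw [← Set.union_compl_self S]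
          exact measure_union_le _ _
      _ ≤ N S := by
          rw [hneg, add_zero, h1]
          exact le_self_add
      _ ≤ N Set.univ := measure_mono (Set.subset_univ _)
  rw [Measure.add_apply, measureReal_def, measureReal_def,
    ← ENNReal.toReal_add (measure_ne_top _ _) (measure_ne_top _ _)]
  exact ENNReal.toReal_mono (by finiteness) (add_le_add hP hN)

lemma sInt_le_norm_mul_tvNorm {Θ : Type*} [TopologicalSpace Θ] [MeasurableSpace Θ]
    (μ : SignedMeasure Θ) (f : C₀(Θ, ℝ)) :
    sInt μ (fun θ => f θ) ≤ ‖f‖ * tvNorm μ := by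
  have key : ∀ (ν : Measure Θ) [IsFiniteMeasure ν], |∫ θ, f θ ∂ν| ≤ ‖f‖ * ν.real Set.univ :=
    fun ν _ => norm_integral_le_of_norm_le_const
      (Eventually.of_forall fun θ => f.toBCF.norm_coe_le_norm θ)
  have h1 := (le_abs_self _).trans (key μ.toJordanDecomposition.posPart)
  have h2 := (neg_le_abs _).trans (key μ.toJordanDecomposition.negPart)
  have h3 : tvNorm μ = μ.toJordanDecomposition.posPart.real Set.univ +
      μ.toJordanDecomposition.negPart.real Set.univ := by
    rw [tvNorm, SignedMeasure.totalVariation, Measure.add_apply,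
      ENNReal.toReal_add (measure_ne_top _ _) (measure_ne_top _ _)]
    rfl
  rw [sInt, h3, mul_add]
  linarith

section C0

variable {Θ : Type*} [TopologicalSpace Θ] [MeasurableSpace Θ] [OpensMeasurableSpace Θ]

lemma ZeroAtInftyContinuousMap.integrable (f : C₀(Θ, ℝ)) (μ : Measure Θ) [IsFiniteMeasure μ] :
    Integrable (fun θ => f θ) μ :=
  Integrable.of_bound f.continuous.measurable.aestronglyMeasurable ‖f‖
    (Eventually.of_forall fun θ => f.toBCF.norm_coe_le_norm θ)

/-- A weighted sum of point masses, as a signed measure. -/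
lemma exists_signedMeasure_atoms {n : ℕ} (a : Fin n → ℝ) (θ : Fin n → Θ) :
    ∃ μ : SignedMeasure Θ, tvNorm μ ≤ ∑ i, |a i| ∧
      ∀ f : C₀(Θ, ℝ), sInt μ (fun θ => f θ) = ∑ i, a i * f (θ i) := by
  have hint : ∀ (b : Fin n → ℝ) (f : C₀(Θ, ℝ)),
      ∫ x, f x ∂(∑ i, (b i).toNNReal • Measure.dirac (θ i)) =
        ∑ i, max (b i) 0 * f (θ i) := by
    intro b f
    rw [integral_finsetSum_measure fun i _ => f.integrable _]
    refine Finset.sum_congr rfl fun i _ => ?_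
    rw [integral_smul_nnreal_measure,
      integral_dirac' (fun θ => f θ) _ f.continuous.measurable.stronglyMeasurable, NNReal.smul_def,
      Real.coe_toNNReal', smul_eq_mul]
  have hmass : ∀ b : Fin n → ℝ,
      (∑ i, (b i).toNNReal • Measure.dirac (θ i)).real Set.univ = ∑ i, max (b i) 0 := by
    intro b
    rw [measureReal_def, Measure.finsetSum_apply, ENNReal.toReal_sum (by finiteness)]
    refine Finset.sum_congr rfl fun i _ => ?_
    simp
  refine ⟨_, (tvNorm_toSignedMeasure_sub_le (∑ i, (a i).toNNReal • Measure.dirac (θ i))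
    (∑ i, (-a i).toNNReal • Measure.dirac (θ i))).trans_eq ?_, fun f => ?_⟩
  · rw [hmass, hmass fun i => -a i, ← Finset.sum_add_distrib]
    refine Finset.sum_congr rfl fun i _ => ?_
    rcases le_total 0 (a i) with h | h
    · simp [h, abs_of_nonneg h]
    · simp [h, abs_of_nonpos h]
  · rw [sInt_toSignedMeasure_sub _ _ fun μ _ => f.integrable μ, hint, hint fun i => -a i,
      ← Finset.sum_sub_distrib]
    refine Finset.sum_congr rfl fun i _ => ?_
    rcases le_total 0 (a i) with h | h
    · simp [h]
    · simp [h]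

lemma sInt_sum_smul {I : Type*} [Fintype I] (μ : SignedMeasure Θ) (d : I → ℝ)
    (v : I → C₀(Θ, ℝ)) :
    sInt μ (fun θ => (∑ p, d p • v p) θ) = ∑ p, d p * sInt μ (fun θ => v p θ) := by
  have key : ∀ (ν : Measure Θ) [IsFiniteMeasure ν],
      ∫ θ, (∑ p, d p • v p) θ ∂ν = ∑ p, d p * ∫ θ, v p θ ∂ν := by
    intro ν _
    simp only [ZeroAtInftyContinuousMap.sum_smul_apply]
    rw [integral_finsetSum _ fun p _ => ((v p).integrable ν).const_mul (d p)]
    simp only [integral_const_mul]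
  rw [sInt, key, key, ← Finset.sum_sub_distrib]
  simp only [sInt, mul_sub]

end C0

/-- Let `ĉ` solve the dual problem, `C*` its optimal value,
`ĝ := C*·∑_{k,j} ĉ_{kj} K_k(x_j,·)`.  Then the MNI problem has a solution of the form
`f̂(x) = ∑_{ℓ=1}^{tm} γ_ℓ sign(ĝ(θ_ℓ)) K(x, θ_ℓ)` with `∑ γ_ℓ = ‖ĝ‖_∞` and
`θ_ℓ ∈ Θ(ĝ)`, where `K(x,θ) = N(x,θ)ρ(θ)`. -/
theorem statement_16
    (σ : ℝ → ℝ) (hσ : Continuous σ) (m : ℕ → ℕ) (D : ℕ) (hD : 0 < D)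
    (ρ : Params m D → ℝ) (hρc : Continuous ρ) (hρpos : ∀ θ, 0 < ρ θ)
    (Kb : (Fin (m 0) → ℝ) → Fin (m D) → C₀(Params m D, ℝ))
    (hKb : ∀ x k θ, Kb x k θ = NNet σ m D θ x k * ρ θ)
    (M : ℕ) (x : Fin M → (Fin (m 0) → ℝ)) (hx : Function.Injective x)
    (Y : Fin (m D) → Fin M → ℝ) (hY : Y ≠ 0)
    (hLI : LinearIndependent ℝ (fun p : Fin (m D) × Fin M => Kb (x p.2) p.1))
    (c : Fin (m D) → Fin M → ℝ) (hc : dualSolves m D Kb M x Y c) :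
    ∃ (γ : Fin (m D * M) → ℝ) (θs : Fin (m D * M) → Params m D),
      (∑ ℓ, γ ℓ) = ‖ghat m D Kb M x Y c‖
      ∧ (∀ ℓ, θs ℓ ∈ ThetaSet m D (ghat m D Kb M x Y c))
      ∧ (fun (x' : Fin (m 0) → ℝ) (k : Fin (m D)) =>
            ∑ ℓ, γ ℓ * Real.sign (ghat m D Kb M x Y c (θs ℓ)) *
              (NNet σ m D (θs ℓ) x' k * ρ (θs ℓ)))
          ∈ MNISolSet σ m D ρ M x Y := by
  classical
  let v : Fin (m D) × Fin M → C₀(Params m D, ℝ) := fun p => Kb (x p.2) p.1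
  let y : Fin (m D) × Fin M → ℝ := fun p => Y p.1 p.2
  have hcomb : ∀ d : Fin (m D) × Fin M → ℝ,
      ∑ k, ∑ j, (fun k j => d (k, j)) k j • Kb (x j) k = ∑ p, d p • v p := fun d =>
    (Fintype.sum_prod_type (fun p => d p • v p)).symm
  have hobj : ∀ d : Fin (m D) × Fin M → ℝ,
      dualObjective m D M Y (fun k j => d (k, j)) = ∑ p, d p * y p := fun d =>
    (Fintype.sum_prod_type (fun p => d p * y p)).symm
  let c' : Fin (m D) × Fin M → ℝ := fun p => c p.1 p.2
  have hgc : ∑ k, ∑ j, c k j • Kb (x j) k = ∑ p, c' p • v p := hcomb c'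
  set C := dualObjective m D M Y c
  have hcy : ∑ p, c' p * y p = C := (hobj c').symm
  have hg : ‖∑ p, c' p • v p‖ = 1 := hgc ▸ hc.1
  have hpos : ∀ d : Fin (m D) × Fin M → ℝ, d ≠ 0 → 0 < ‖∑ p, d p • v p‖ := by
    intro d hd
    rw [norm_pos_iff]
    exact fun h => hd (funext (Fintype.linearIndependent_iff.1 hLI d h))
  have hle : ∀ d : Fin (m D) × Fin M → ℝ, ∑ p, d p * y p ≤ C * ‖∑ p, d p • v p‖ := by
    intro d
    by_cases hd : d = 0
    · simp [hd]
    have hn := hpos d hd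
    have hsm : ∑ p, (‖∑ p, d p • v p‖⁻¹ * d p) • v p
        = ‖∑ p, d p • v p‖⁻¹ • ∑ p, d p • v p := by
      simp only [Finset.smul_sum, smul_smul]
    have h := hc.2 (fun k j => ‖∑ p, d p • v p‖⁻¹ * d (k, j)) (by
      rw [dualFeasible, hcomb fun p => ‖∑ p, d p • v p‖⁻¹ * d p, hsm, norm_smul, norm_inv,
        norm_norm, inv_mul_cancel₀ hn.ne'])
    rw [hobj fun p => ‖∑ p, d p • v p‖⁻¹ * d p] at h
    simp only [mul_assoc] at h
    rwa [← Finset.mul_sum, inv_mul_eq_div, div_le_iff₀ hn] at h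
  have hy : y ≠ 0 := fun h => hY (by
    ext k j
    exact congrFun h (k, j))
  have hC : 0 < C := by
    have h1 : 0 < ∑ p, y p * y p := by
      refine lt_of_le_of_ne (Finset.sum_nonneg fun p _ => mul_self_nonneg _) fun h => hy ?_
      ext p
      simpa using (Finset.sum_eq_zero_iff_of_nonneg fun p _ => mul_self_nonneg (y p)).1 h.symm p
        (Finset.mem_univ p)
    exact pos_of_mul_pos_left (h1.trans_le (hle y)) (norm_nonneg _)
  obtain ⟨w, θ, hw, hw1, hθ, hwv⟩ := exists_extremal_convex_combination
    (n := m D * M) (by simp) v y c' hC hcy hg hle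
  have hghat : ghat m D Kb M x Y c = C • ∑ p, c' p • v p := by
    rw [ghat, hgc]
  have hghat_norm : ‖ghat m D Kb M x Y c‖ = C := by
    rw [hghat, norm_smul, hg, mul_one, Real.norm_of_nonneg hC.le]
  have hghat_apply : ∀ θ, ghat m D Kb M x Y c θ = C * (∑ p, c' p • v p) θ := fun θ => by
    rw [hghat]
    rfl
  have hsign : ∀ i, Real.sign (ghat m D Kb M x Y c (θ i)) =
      Real.sign ((∑ p, c' p • v p) (θ i)) := fun i => by
    rw [hghat_apply]
    rcases lt_trichotomy ((∑ p, c' p • v p) (θ i)) 0 with h | h | h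
    · rw [Real.sign_of_neg h, Real.sign_of_neg (mul_neg_of_pos_of_neg hC h)]
    · rw [h, mul_zero]
    · rw [Real.sign_of_pos h, Real.sign_of_pos (mul_pos hC h)]
  have hsign_abs : ∀ r : ℝ, |Real.sign r| ≤ 1 := fun r => by
    rcases Real.sign_apply_eq r with h | h | h <;> simp [h]
  let a : Fin (m D * M) → ℝ := fun i => C * w i * Real.sign (ghat m D Kb M x Y c (θ i))
  obtain ⟨μ, hμtv, hμ⟩ := exists_signedMeasure_atoms a θ
  have hfMu : ∀ (ν : SignedMeasure (Params m D)) x' k,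
      fMu σ m D ρ ν x' k = sInt ν fun θ => Kb x' k θ := fun ν x' k => by
    simp only [fMu, hKb]
  have hf : fMu σ m D ρ μ = fun (x' : Fin (m 0) → ℝ) (k : Fin (m D)) =>
      ∑ ℓ, C * w ℓ * Real.sign (ghat m D Kb M x Y c (θ ℓ)) *
        (NNet σ m D (θ ℓ) x' k * ρ (θ ℓ)) := by
    ext x' k
    rw [hfMu, hμ]
    simp only [hKb, a]
  have htv : tvNorm μ ≤ C := by
    refine hμtv.trans ?_
    calc ∑ i, |a i| ≤ ∑ i, C * w i := Finset.sum_le_sum fun i _ => by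
          rw [abs_mul, abs_of_nonneg (mul_nonneg hC.le (hw i))]
          exact mul_le_of_le_one_right (mul_nonneg hC.le (hw i)) (hsign_abs _)
      _ = C := by rw [← Finset.mul_sum, hw1, mul_one]
  have hlower : ∀ ν : SignedMeasure (Params m D), interpolates m D M x Y (fMu σ m D ρ ν) →
      C ≤ tvNorm ν := by
    intro ν hν
    have h := sInt_le_norm_mul_tvNorm ν (∑ p, c' p • v p)
    rw [hg, one_mul, sInt_sum_smul] at h
    refine le_trans (le_of_eq ?_) h
    rw [← hcy]
    refine Finset.sum_congr rfl fun p _ => ?_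
    rw [← hfMu, hν p.2 p.1]
  refine ⟨fun i => C * w i, θ, ?_, fun i => ?_, ?_⟩
  · rw [← Finset.mul_sum, hw1, mul_one, hghat_norm]
  · change |ghat m D Kb M x Y c (θ i)| = _
    rw [hghat_norm, hghat_apply, abs_mul, hθ i, mul_one, abs_of_pos hC]
  · rw [← hf]
    refine ⟨⟨μ, rfl⟩, fun j k => ?_, fun ν hν => ?_⟩
    · rw [hfMu, hμ]
      have h := hwv (k, j)
      rw [eq_div_iff hC.ne', Finset.sum_mul] at h
      rw [← show y (k, j) = Y k j from rfl, ← h]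
      refine Finset.sum_congr rfl fun i _ => ?_
      simp only [a, hsign, v]
      ring
    · have hupper : BNnorm σ m D ρ (fMu σ m D ρ μ) ≤ C := by
        rw [BNnorm]
        refine le_trans (csInf_le ⟨0, ?_⟩ ⟨μ, rfl, rfl⟩) htv
        rintro _ ⟨ν', -, rfl⟩
        exact ENNReal.toReal_nonneg
      refine hupper.trans ?_
      rw [BNnorm]
      refine le_csInf ⟨_, ν, rfl, rfl⟩ ?_
      rintro _ ⟨ν', hν', rfl⟩
      refine hlower ν' ?_
      have h : fMu σ m D ρ ν' = fMu σ m D ρ ν := hν'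
      rwa [h]

end
end
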